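/- arXiv:math/0509524 — 9 statements merged into one kernel-verified Lean document; each statement's English description precedes it below -/
import Mathlib

section
/- For every integer n ≥ 1 and every x ∈ [0,1], the n-fold iterate satisfies f_n(x) = (u/d) · (1 − (u/d)^n − x·(1 − (u/d)^{n−1})) / (1 − (u/d)^{n+1} − x·(1 − (u/d)^n)); in particular the denominator is nonzero for every x ∈ [0,1]. -/
/-- The map `f(x) = u/(1 - d x)` with `u = 1/2 + ε`, `d = 1/2 - ε`. -/
noncomputable def fstep (ε : ℝ) (x : ℝ) : ℝ := (1/2 + ε) / (1 - (1/2 - ε) * x)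

/-- The denominator of the closed form of the iterates is negative when the ratio exceeds `1`. -/
theorem iterate_denom_neg {r x : ℝ} (hr : 1 < r) (hx : x ≤ 1) (n : ℕ) :
    1 - r ^ (n + 1) - x * (1 - r ^ n) < 0 := by
  have h : 1 ≤ r ^ n := one_le_pow₀ hr.le
  have h' : 0 ≤ (r ^ n - 1) * (r - x) := mul_nonneg (by linarith) (by linarith)
  rw [pow_succ]
  linarith

/-- The closed form of the iterates of `x ↦ d r / (1 - d x)` when `d (1 + r) = 1`. -/
theorem iterate_succ_closed_form {d r x : ℝ} (hd : d * (1 + r) = 1) (hr : 1 < r) (hx : x ≤ 1)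
    (n : ℕ) :
    (fun y => d * r / (1 - d * y))^[n + 1] x =
      r * (1 - r ^ (n + 1) - x * (1 - r ^ n)) /
        (1 - r ^ (n + 2) - x * (1 - r ^ (n + 1))) := by
  have hd0 : d ≠ 0 := left_ne_zero_of_mul_eq_one hd
  induction n with
  | zero =>
    have h : 1 - r ^ 2 - x * (1 - r) ≠ 0 := by
      simpa using (iterate_denom_neg hr hx 1).ne
    have h' : 1 - d * x ≠ 0 := by
      have e : 1 - d * x = d * (1 + r - x) := by linear_combination -hd
      rw [e]
      exact mul_ne_zero hd0 (by linarith)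
    simp only [zero_add, Function.iterate_one, pow_one, pow_zero, sub_self, mul_zero, sub_zero]
    rw [div_eq_div_iff h' h]
    linear_combination (r - r ^ 2) * hd
  | succ k ih =>
    have h := (iterate_denom_neg hr hx (k + 1)).ne
    have h' := (iterate_denom_neg hr hx (k + 2)).ne
    rw [Function.iterate_succ_apply', ih]
    have e : 1 - d * (r * (1 - r ^ (k + 1) - x * (1 - r ^ k)) /
          (1 - r ^ (k + 2) - x * (1 - r ^ (k + 1)))) =
        d * (1 - r ^ (k + 3) - x * (1 - r ^ (k + 2))) /
          (1 - r ^ (k + 2) - x * (1 - r ^ (k + 1))) := by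
      rw [eq_div_iff h, sub_mul, mul_assoc d, div_mul_cancel₀ _ h]
      linear_combination -(1 - r ^ (k + 2) - x * (1 - r ^ (k + 1))) * hd
    rw [e, div_div_eq_mul_div, mul_assoc, mul_div_mul_left _ _ hd0]

/-- For every `n ≥ 1` and `x ∈ [0,1]`, the `n`-fold iterate of `f` satisfies
`f_n(x) = (u/d)·(1 − (u/d)^n − x(1 − (u/d)^{n−1})) / (1 − (u/d)^{n+1} − x(1 − (u/d)^n))`,
and in particular the denominator is nonzero. -/
theorem stmt0 (ε : ℝ) (hε : ε ∈ Set.Ioo (0:ℝ) (1/2))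
    (n : ℕ) (hn : 1 ≤ n) (x : ℝ) (hx : x ∈ Set.Icc (0:ℝ) 1) :
    (1 - ((1/2+ε)/(1/2-ε))^(n+1) - x * (1 - ((1/2+ε)/(1/2-ε))^n)) ≠ 0 ∧
    (fstep ε)^[n] x =
      ((1/2+ε)/(1/2-ε)) *
        (1 - ((1/2+ε)/(1/2-ε))^n - x * (1 - ((1/2+ε)/(1/2-ε))^(n-1))) /
        (1 - ((1/2+ε)/(1/2-ε))^(n+1) - x * (1 - ((1/2+ε)/(1/2-ε))^n)) := by
  obtain ⟨h0, h1⟩ := hε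
  have hd : (0 : ℝ) < 1/2 - ε := by linarith
  have hr : 1 < (1/2+ε)/(1/2-ε) := by rw [one_lt_div hd]; linarith
  have hu : (1/2-ε) * ((1/2+ε)/(1/2-ε)) = 1/2+ε := mul_div_cancel₀ _ hd.ne'
  refine ⟨(iterate_denom_neg hr hx.2 n).ne, ?_⟩
  obtain ⟨k, rfl⟩ := Nat.exists_eq_add_of_le' hn
  have hf : fstep ε = fun y => (1/2-ε) * ((1/2+ε)/(1/2-ε)) / (1 - (1/2-ε) * y) := by
    rw [hu]
    rfl
  rw [hf]
  exact iterate_succ_closed_form (by linear_combination hu) hr hx.2 k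
end

section
/- For every δ > 0, lim_{ε→0+} ( f^{(ε)}_{⌊δ/ε⌋}(0) )^{⌊1/ε⌋} = exp( −4/(e^{4δ} − 1) ); in particular this limit is strictly positive. -/
open Filter

/-- If `b → 0` and `m * b → c` with `m` integer valued, then `(1 + b) ^ m → exp c`. -/
theorem tendsto_one_add_pow_exp_of_tendsto_mul {α : Type*} {l : Filter α} {b : α → ℝ}
    {m : α → ℕ} {c : ℝ} (hb : Tendsto b l (nhds 0))
    (hmb : Tendsto (fun x => (m x : ℝ) * b x) l (nhds c)) :
    Tendsto (fun x => (1 + b x) ^ m x) l (nhds (Real.exp c)) := by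
  have hb1 : Tendsto (fun x => 1 + b x) l (nhds 1) := by simpa using hb.const_add 1
  have hcont : ContinuousAt (dslope Real.log 1) 1 :=
    continuousAt_dslope_same.2 (Real.differentiableAt_log one_ne_zero)
  have hslope : Tendsto (fun x => dslope Real.log 1 (1 + b x)) l (nhds 1) := by
    have h := hcont.tendsto.comp hb1
    simpa [dslope_same, Function.comp_def] using h
  have hlog : Tendsto (fun x => Real.exp ((m x : ℝ) * b x * dslope Real.log 1 (1 + b x))) l
      (nhds (Real.exp c)) := by
    simpa [Function.comp_def] using (Real.continuous_exp.tendsto _).comp (hmb.mul hslope)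
  refine hlog.congr' ?_
  filter_upwards [hb1.eventually (lt_mem_nhds one_pos)] with x hx
  have h : b x * dslope Real.log 1 (1 + b x) = Real.log (1 + b x) := by
    simpa using sub_smul_dslope Real.log 1 (1 + b x)
  rw [mul_assoc, h, Real.exp_nat_mul, Real.exp_log hx]

theorem tendsto_natFloor_div_mul_self {a : ℝ} (ha : 0 ≤ a) :
    Tendsto (fun ε : ℝ => (⌊a / ε⌋₊ : ℝ) * ε) (nhdsWithin 0 (Set.Ioi 0)) (nhds a) := by
  have h := (tendsto_nat_floor_mul_div_atTop ha).comp (tendsto_inv_nhdsGT_zero (𝕜 := ℝ))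
  simpa [Function.comp_def, div_eq_mul_inv] using h

theorem fstep_iterate_denominator_pos {ε : ℝ} (h0 : 0 < ε) (h1 : ε < 1 / 2) (n : ℕ) :
    0 < (1 / 2 + ε) * (1 + 2 * ε / (1 / 2 - ε)) ^ n - (1 / 2 - ε) := by
  have hd : 0 < 1 / 2 - ε := by linarith
  have hr : 1 ≤ (1 + 2 * ε / (1 / 2 - ε)) ^ n :=
    one_le_pow₀ (le_add_of_nonneg_right (by positivity))
  nlinarith

/-- Closed form of the orbit of `0`. -/
theorem fstep_iterate_zero {ε : ℝ} (h0 : 0 < ε) (h1 : ε < 1 / 2) (n : ℕ) :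
    (fstep ε)^[n] 0 =
      1 + -(2 * ε / ((1 / 2 + ε) * (1 + 2 * ε / (1 / 2 - ε)) ^ n - (1 / 2 - ε))) := by
  have hd : 0 < 1 / 2 - ε := by linarith
  induction n with
  | zero =>
    have : (1 / 2 + ε) * 1 - (1 / 2 - ε) = 2 * ε := by ring
    simp only [Function.iterate_zero, id, pow_zero, this]
    rw [div_self (by positivity)]
    norm_num
  | succ n ih =>
    rw [Function.iterate_succ_apply', ih, fstep]
    have hD := fstep_iterate_denominator_pos h0 h1 n
    set D := (1 / 2 + ε) * (1 + 2 * ε / (1 / 2 - ε)) ^ n - (1 / 2 - ε) with hDdef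
    have hrec : (1 / 2 + ε) * (1 + 2 * ε / (1 / 2 - ε)) ^ (n + 1) - (1 / 2 - ε) =
        ((1 / 2 + ε) * D + 2 * ε * (1 / 2 - ε)) / (1 / 2 - ε) := by
      have hr : 1 + 2 * ε / (1 / 2 - ε) = (1 / 2 + ε) / (1 / 2 - ε) := by
        rw [eq_div_iff hd.ne', add_mul, div_mul_cancel₀ _ hd.ne']
        ring
      rw [hDdef, pow_succ, eq_div_iff hd.ne', hr]
      generalize ((1 / 2 + ε) / (1 / 2 - ε)) ^ n = p
      rw [sub_mul, mul_assoc, mul_assoc, div_mul_cancel₀ _ hd.ne']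
      ring
    have hE : 0 < (1 / 2 + ε) * D + 2 * ε * (1 / 2 - ε) := by positivity
    have hden : 1 - (1 / 2 - ε) * (1 + -(2 * ε / D)) =
        ((1 / 2 + ε) * D + 2 * ε * (1 / 2 - ε)) / D := by
      rw [eq_div_iff hD.ne']
      linear_combination (1 / 2 - ε) * div_mul_cancel₀ (2 * ε) hD.ne'
    rw [hrec, hden, div_div_eq_mul_div, div_div_eq_mul_div, div_eq_iff hE.ne']
    linear_combination div_mul_cancel₀ (2 * ε * (1 / 2 - ε)) hE.ne'

/-- For every `δ > 0`,
`lim_{ε→0+} ( f^{(ε)}_{⌊δ/ε⌋}(0) )^{⌊1/ε⌋} = exp( −4/(e^{4δ} − 1) )`,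
and this limit is strictly positive. -/
theorem stmt1 (δ : ℝ) (hδ : 0 < δ) :
    Tendsto (fun ε : ℝ => ((fstep ε)^[⌊δ/ε⌋₊] 0) ^ ⌊1/ε⌋₊)
      (nhdsWithin 0 (Set.Ioo 0 (1/2)))
      (nhds (Real.exp (-4 / (Real.exp (4*δ) - 1)))) ∧
    0 < Real.exp (-4 / (Real.exp (4*δ) - 1)) := by
  refine ⟨?_, Real.exp_pos _⟩
  have hle : nhdsWithin (0 : ℝ) (Set.Ioo 0 (1 / 2)) ≤ nhdsWithin 0 (Set.Ioi 0) :=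
    nhdsWithin_mono _ Set.Ioo_subset_Ioi_self
  have hε : Tendsto (fun ε : ℝ => ε) (nhdsWithin 0 (Set.Ioo 0 (1 / 2))) (nhds 0) :=
    tendsto_id.mono_left nhdsWithin_le_nhds
  have hu : Tendsto (fun ε : ℝ => 1 / 2 + ε) (nhdsWithin 0 (Set.Ioo 0 (1 / 2)))
      (nhds (1 / 2)) := by
    simpa only [add_zero] using hε.const_add (1 / 2)
  have hd : Tendsto (fun ε : ℝ => 1 / 2 - ε) (nhdsWithin 0 (Set.Ioo 0 (1 / 2)))
      (nhds (1 / 2)) := by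
    simpa only [sub_zero] using hε.const_sub (1 / 2)
  have hexp : 0 < Real.exp (4 * δ) - 1 := sub_pos.2 (Real.one_lt_exp_iff.2 (by positivity))
  have hpow : Tendsto (fun ε : ℝ => (1 + 2 * ε / (1 / 2 - ε)) ^ ⌊δ / ε⌋₊)
      (nhdsWithin 0 (Set.Ioo 0 (1 / 2))) (nhds (Real.exp (4 * δ))) := by
    apply tendsto_one_add_pow_exp_of_tendsto_mul
    · simpa [Pi.div_def] using (hε.const_mul 2).div hd (by norm_num)
    · have h := (((tendsto_natFloor_div_mul_self hδ.le).mono_left hle).const_mul 2).div hd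
        (by norm_num)
      convert h using 2
      · simp only [Pi.div_apply]
        ring
      · ring
  have hD : Tendsto
      (fun ε : ℝ => (1 / 2 + ε) * (1 + 2 * ε / (1 / 2 - ε)) ^ ⌊δ / ε⌋₊ - (1 / 2 - ε))
      (nhdsWithin 0 (Set.Ioo 0 (1 / 2))) (nhds (1 / 2 * Real.exp (4 * δ) - 1 / 2)) :=
    (hu.mul hpow).sub hd
  have hD0 : 1 / 2 * Real.exp (4 * δ) - 1 / 2 ≠ 0 := by linarith
  have hmain : Tendsto
      (fun ε : ℝ => (1 + -(2 * ε /
        ((1 / 2 + ε) * (1 + 2 * ε / (1 / 2 - ε)) ^ ⌊δ / ε⌋₊ - (1 / 2 - ε)))) ^ ⌊1 / ε⌋₊)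
      (nhdsWithin 0 (Set.Ioo 0 (1 / 2)))
      (nhds (Real.exp (-4 / (Real.exp (4 * δ) - 1)))) := by
    apply tendsto_one_add_pow_exp_of_tendsto_mul
    · simpa [Pi.div_def] using ((hε.const_mul 2).div hD hD0).neg
    · have h := (((tendsto_natFloor_div_mul_self zero_le_one).mono_left hle).const_mul
        (-2)).div hD hD0
      convert h using 2
      · simp only [Pi.div_apply]
        ring
      · rw [div_eq_div_iff hexp.ne' hD0]
        ring
  refine hmain.congr' ?_
  filter_upwards [self_mem_nhdsWithin] with ε h
  rw [fstep_iterate_zero h.1 h.2]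
end

section
/- For every nonempty word v = m₁…m_n ∈ 𝕌 with a_{m_k} > 0 for all 1 ≤ k ≤ n, and every x ∈ [0,1], one has 1 − f_v(1 − x) = x / (A(v)·x + B(v)). -/
/-- `f_i(x) = f(1 - a_i + a_i x)`. -/
noncomputable def fi (ε : ℝ) (a : ℕ+ → ℝ) (i : ℕ+) (x : ℝ) : ℝ :=
  fstep ε (1 - a i + a i * x)

/-- For a word `v = m₁…m_n`, `f_v = f_{m₁} ∘ ⋯ ∘ f_{m_n}` (with `f_∅ = id`). -/
noncomputable def fword (ε : ℝ) (a : ℕ+ → ℝ) (v : List ℕ+) : ℝ → ℝ :=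
  v.foldr (fun m g => fi ε a m ∘ g) id

/-- `a_v = a_{m₁} ⋯ a_{m_n}` (with `a_∅ = 1`). -/
noncomputable def aword (a : ℕ+ → ℝ) (v : List ℕ+) : ℝ := (v.map a).prod

/-- `B(v) = (u/d)^n / a_v`. -/
noncomputable def Bword (ε : ℝ) (a : ℕ+ → ℝ) (v : List ℕ+) : ℝ :=
  ((1/2+ε)/(1/2-ε))^(v.length) / aword a v

/-- `A(v) = 1 + (u/d)/a_{m₁} + (u/d)²/(a_{m₁}a_{m₂}) + ⋯ + (u/d)^{n−1}/(a_{m₁}⋯a_{m_{n−1}})`. -/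
noncomputable def Aword (ε : ℝ) (a : ℕ+ → ℝ) (v : List ℕ+) : ℝ :=
  ∑ k ∈ Finset.range v.length, ((1/2+ε)/(1/2-ε))^k / aword a (v.take k)

theorem aword_cons (a : ℕ+ → ℝ) (m : ℕ+) (v : List ℕ+) :
    aword a (m :: v) = a m * aword a v := by
  simp [aword]

theorem Bword_cons (ε : ℝ) (a : ℕ+ → ℝ) (m : ℕ+) (v : List ℕ+) :
    Bword ε a (m :: v) = (1/2+ε)/(1/2-ε) / a m * Bword ε a v := by
  simp only [Bword, aword_cons, List.length_cons, pow_succ']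
  rw [div_mul_div_comm]

theorem Aword_cons (ε : ℝ) (a : ℕ+ → ℝ) (m : ℕ+) (v : List ℕ+) :
    Aword ε a (m :: v) = 1 + (1/2+ε)/(1/2-ε) / a m * Aword ε a v := by
  simp only [Aword, List.length_cons]
  rw [Finset.sum_range_succ', Finset.mul_sum, add_comm]
  congr 1
  · simp [aword]
  · refine Finset.sum_congr rfl fun k _ => ?_
    rw [List.take_succ_cons, aword_cons, pow_succ', div_mul_div_comm]

/-- In the coordinate `y = 1 - x`, the map `f_i` is a Möbius map fixing `0`. -/
theorem one_sub_fi_one_sub {ε : ℝ} (hε : ε ∈ Set.Ioo (0:ℝ) (1/2)) {a : ℕ+ → ℝ} {m : ℕ+}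
    (hm : 0 < a m) {y : ℝ} (hy : 0 ≤ y) :
    1 - fi ε a m (1 - y) = y / (y + (1/2+ε)/(1/2-ε) / a m) := by
  obtain ⟨h0, h1⟩ := hε
  have hu : 0 < 1/2 + ε := by linarith
  have hd : 0 < 1/2 - ε := by linarith
  have hden : 1 - (1/2 - ε) * (1 - a m + a m * (1 - y)) = (1/2 + ε) + (1/2 - ε) * a m * y := by
    ring
  rw [fi, fstep, hden]
  generalize 1/2 + ε = u at *
  generalize 1/2 - ε = d at *
  have : 0 < u + d * a m * y := by positivity
  have : 0 < y + u / d / a m := by positivity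
  rw [one_sub_div (by positivity), div_eq_div_iff (by positivity) (by positivity)]
  field_simp
  ring

theorem one_sub_fword_one_sub {ε : ℝ} (hε : ε ∈ Set.Ioo (0:ℝ) (1/2)) {a : ℕ+ → ℝ}
    {v : List ℕ+} (hpos : ∀ m ∈ v, 0 < a m) {x : ℝ} (hx : 0 ≤ x) :
    0 ≤ Aword ε a v ∧ 0 < Bword ε a v ∧
      1 - fword ε a v (1 - x) = x / (Aword ε a v * x + Bword ε a v) := by
  induction v with
  | nil => simp [Aword, Bword, aword, fword]
  | cons m v ih =>
    obtain ⟨hA, hB, h⟩ := ih fun k hk => hpos k (List.mem_cons_of_mem m hk)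
    have hm : 0 < a m := hpos m List.mem_cons_self
    have hr : 0 < (1/2+ε)/(1/2-ε) / a m :=
      div_pos (div_pos (by linarith [hε.1]) (by linarith [hε.2])) hm
    have hfw : fword ε a (m :: v) (1 - x) =
        fi ε a m (1 - (1 - fword ε a v (1 - x))) := by
      simp [fword]
    rw [Aword_cons, Bword_cons, hfw, h, one_sub_fi_one_sub hε hm (by positivity)]
    generalize (1/2+ε)/(1/2-ε) / a m = r at *
    refine ⟨by positivity, by positivity, ?_⟩
    have hD : 0 < Aword ε a v * x + Bword ε a v := by positivity
    have hE : (1 + r * Aword ε a v) * x + r * Bword ε a v =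
        x + r * (Aword ε a v * x + Bword ε a v) := by ring
    rw [hE]
    generalize Aword ε a v * x + Bword ε a v = D at *
    rw [div_add' _ _ _ hD.ne', div_div_div_cancel_right₀ hD.ne']

/-- For every nonempty word `v` with all letters of positive weight, and every `x ∈ [0,1]`,
`1 − f_v(1 − x) = x / (A(v)x + B(v))`. -/
theorem stmt2 (ε : ℝ) (hε : ε ∈ Set.Ioo (0:ℝ) (1/2))
    (a : ℕ+ → ℝ) (ha0 : ∀ i, 0 ≤ a i) (ha1 : ∀ i, a i < 1) (hsum : HasSum a 1)
    (haplus : (⨆ i, a i) < 1)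
    (v : List ℕ+) (hv : v ≠ []) (hpos : ∀ m ∈ v, 0 < a m)
    (x : ℝ) (hx : x ∈ Set.Icc (0:ℝ) 1) :
    1 - fword ε a v (1 - x) = x / (Aword ε a v * x + Bword ε a v) := by
  exact (one_sub_fword_one_sub hε hpos hx.1).2.2
end

section
/- For every nonempty word v = m₁…m_n ∈ 𝕌 with a_{m_k} > 0 for all 1 ≤ k ≤ n, the function f_v extends to a smooth (rational) function on a neighbourhood of 1 (its unique pole lies strictly to the right of 1), and for every integer p ≥ 1 its p-th derivative at 1 equals f_v^{(p)}(1) = p! · (1/B(v)) · (A(v)/B(v))^{p−1}. -/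
theorem aword_pos {a : ℕ+ → ℝ} {v : List ℕ+} (hpos : ∀ m ∈ v, 0 < a m) : 0 < aword a v :=
  List.prod_pos (by simpa using hpos)

theorem Bword_pos {ε : ℝ} (hε : ε ∈ Set.Ioo (0:ℝ) (1/2)) {a : ℕ+ → ℝ} {v : List ℕ+}
    (hpos : ∀ m ∈ v, 0 < a m) : 0 < Bword ε a v :=
  div_pos (pow_pos (div_pos (by linarith [hε.1]) (by linarith [hε.2])) _) (aword_pos hpos)

theorem Aword_nonneg {ε : ℝ} (hε : ε ∈ Set.Ioo (0:ℝ) (1/2)) {a : ℕ+ → ℝ} {v : List ℕ+}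
    (hpos : ∀ m ∈ v, 0 < a m) : 0 ≤ Aword ε a v :=
  Finset.sum_nonneg fun _ _ =>
    div_nonneg (pow_nonneg (div_nonneg (by linarith [hε.1]) (by linarith [hε.2])) _)
      (aword_pos fun m hm => hpos m (List.mem_of_mem_take hm)).le

/-- To the left of its pole, `f_v` is the Möbius map `x ↦ 1 + (x - 1) / (B(v) - A(v) (x - 1))`. -/
theorem fword_eq_mobius {ε : ℝ} (hε : ε ∈ Set.Ioo (0:ℝ) (1/2)) {a : ℕ+ → ℝ} {v : List ℕ+}
    (hpos : ∀ m ∈ v, 0 < a m) {x : ℝ} (hx : 0 < Bword ε a v - Aword ε a v * (x - 1)) :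
    fword ε a v x = 1 + (x - 1) / (Bword ε a v - Aword ε a v * (x - 1)) := by
  induction v with
  | nil => simp [fword, Bword, Aword, aword]
  | cons m v ih =>
    have hposv : ∀ k ∈ v, 0 < a k := fun k hk => hpos k (List.mem_cons_of_mem m hk)
    have ham : 0 < a m := hpos m List.mem_cons_self
    have hu : 0 < 1/2 + ε := by linarith [hε.1]
    have hd : 0 < 1/2 - ε := by linarith [hε.2]
    have hB := Bword_pos hε hposv
    have hA := Aword_nonneg hε hposv
    rw [Bword_cons, Aword_cons] at hx ⊢
    have hq : 0 < (1/2+ε)/(1/2-ε) / a m := by positivity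
    set q := (1/2+ε)/(1/2-ε) / a m with hq_def
    set A := Aword ε a v
    set B := Bword ε a v
    have hD : 0 < B - A * (x - 1) := by
      rcases le_total 0 (x - 1) with hy | hy
      · have : 0 < q * (B - A * (x - 1)) := by linarith
        exact pos_of_mul_pos_right this hq.le
      · linarith [mul_nonpos_of_nonneg_of_nonpos hA hy]
    have hu_eq : 1/2 + ε = q * (a m * (1/2 - ε)) := by
      rw [hq_def, div_div, mul_comm (a m), div_mul_cancel₀ _ (mul_pos hd ham).ne']
    have hstep : fword ε a (m :: v) x = fi ε a m (fword ε a v x) := rfl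
    rw [hstep, ih hposv hD, fi, fstep]
    set D := B - A * (x - 1) with hD_def
    have hden : 1 - (1/2 - ε) * (1 - a m + a m * (1 + (x - 1) / D))
        = a m * (1/2 - ε) * (q * B - (1 + q * A) * (x - 1)) / D := by
      have : 1 - (1/2 - ε) * (1 - a m + a m * (1 + (x - 1) / D))
          = (1/2 + ε) - (1/2 - ε) * a m * ((x - 1) / D) := by ring
      rw [this, hu_eq, eq_div_iff hD.ne', sub_mul, mul_assoc _ ((x - 1) / D),
        div_mul_cancel₀ _ hD.ne', hD_def]
      ring
    rw [hden, hu_eq]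
    generalize 1/2 - ε = d at hd ⊢
    have hx' := hx.ne'
    field_simp
    rw [hD_def]
    ring

theorem iteratedDeriv_succ_mobius {A B : ℝ} (k : ℕ) {x : ℝ} (hx : 0 < B - A * (x - 1)) :
    iteratedDeriv (k + 1) (fun x : ℝ => 1 + (x - 1) / (B - A * (x - 1))) x =
      (k + 1).factorial * B * A ^ k / (B - A * (x - 1)) ^ (k + 2) := by
  have hden (x : ℝ) : HasDerivAt (fun x : ℝ => B - A * (x - 1)) (-A) x := by
    simpa using (((hasDerivAt_id x).sub_const 1).const_mul A).const_sub B
  induction k generalizing x with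
  | zero =>
    rw [zero_add, iteratedDeriv_one]
    have h := ((((hasDerivAt_id x).sub_const 1).div (hden x) hx.ne').const_add 1).deriv
    refine h.trans ?_
    simp only [id, Nat.factorial_one, Nat.cast_one, pow_zero]
    congr 1
    ring
  | succ k ih =>
    rw [iteratedDeriv_succ]
    have hev : ∀ᶠ y in nhds x, 0 < B - A * (y - 1) :=
      (hden x).continuousAt.eventually (lt_mem_nhds hx)
    have heq : iteratedDeriv (k + 1) (fun x : ℝ => 1 + (x - 1) / (B - A * (x - 1))) =ᶠ[nhds x]
        fun y => (k + 1).factorial * B * A ^ k / (B - A * (y - 1)) ^ (k + 2) :=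
      hev.mono fun y hy => ih hy
    rw [heq.deriv_eq]
    have h := ((hasDerivAt_const x ((k + 1).factorial * B * A ^ k : ℝ)).div
      ((hden x).pow (k + 2)) (pow_ne_zero _ hx.ne')).deriv
    refine h.trans ?_
    have hx' := hx.ne'
    simp only [Pi.pow_apply, Nat.factorial_succ (k + 1),
      show k + 2 - 1 = k + 1 from rfl]
    rw [div_eq_div_iff (by positivity) (by positivity)]
    push_cast
    ring

/-- For every nonempty word `v` with all letters of positive weight: `f_v` is smooth on a
neighbourhood of `1`, and for every `p ≥ 1` its `p`-th derivative at `1` equals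
`p! · (1/B(v)) · (A(v)/B(v))^{p−1}`. -/
theorem stmt3 (ε : ℝ) (hε : ε ∈ Set.Ioo (0:ℝ) (1/2))
    (a : ℕ+ → ℝ) (ha0 : ∀ i, 0 ≤ a i) (ha1 : ∀ i, a i < 1) (hsum : HasSum a 1)
    (haplus : (⨆ i, a i) < 1)
    (v : List ℕ+) (hv : v ≠ []) (hpos : ∀ m ∈ v, 0 < a m) :
    (∃ s : Set ℝ, s ∈ nhds (1:ℝ) ∧ ContDiffOn ℝ (⊤ : ℕ∞) (fword ε a v) s) ∧
    ∀ p : ℕ, 1 ≤ p →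
      iteratedDeriv p (fword ε a v) 1 =
        (p.factorial : ℝ) * (1 / Bword ε a v) * (Aword ε a v / Bword ε a v)^(p-1) := by
  have hB := Bword_pos hε hpos
  have hev : ∀ᶠ x in nhds (1:ℝ), 0 < Bword ε a v - Aword ε a v * (x - 1) := by
    have hc : ContinuousAt (fun x : ℝ => Bword ε a v - Aword ε a v * (x - 1)) 1 := by fun_prop
    exact hc.eventually (lt_mem_nhds (by simpa using hB))
  constructor
  · refine ⟨_, hev, ContDiffOn.congr ?_ fun x hx => fword_eq_mobius hε hpos hx⟩
    exact contDiffOn_const.add (ContDiffOn.div (by fun_prop) (by fun_prop) fun x hx => ne_of_gt hx)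
  · intro p hp
    obtain ⟨k, rfl⟩ := Nat.exists_eq_add_of_le' hp
    have heq : fword ε a v =ᶠ[nhds 1]
        fun x => 1 + (x - 1) / (Bword ε a v - Aword ε a v * (x - 1)) :=
      hev.mono fun x hx => fword_eq_mobius hε hpos hx
    rw [heq.iteratedDeriv_eq, iteratedDeriv_succ_mobius k hev.self_of_nhds]
    simp only [sub_self, mul_zero, sub_zero, Nat.add_sub_cancel, div_pow]
    field_simp
    ring
end

section
/- For every integer p ≥ 1 and every a⁺ ∈ [0,1) there exists a constant K, depending only on p and a⁺, with the following property: for every ε ∈ (0,1/2), every weight sequence (a_i)_{i≥1} with 0 ≤ a_i < 1, ∑_{i≥1} a_i = 1 and sup_i a_i ≤ a⁺, every word v ∈ 𝕌 all of whose letters have positive weight, and every integer l ≥ 1, the p-th derivative of the function x ↦ (f_v(x))^l at x = 1 satisfies (d^p/dx^p)(f_v)^l (1) ≤ K · l^p · a_v · (d/u)^{|v|}. -/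
open Finset in
/-- A weighted Leibniz bound: if the Taylor coefficients of `f` at `x` are nonnegative, `f x = 1`,
and the `k`-th one is at most `M ^ k * β` with `β ≤ 1`, then the `k`-th coefficient of `f ^ l` is
at most `l ^ k * M ^ k * β`. -/
theorem iteratedDeriv_pow_le_of_iteratedDeriv_le {f : ℝ → ℝ} {x M β : ℝ}
    (hf : ContDiffAt ℝ ⊤ f x) (hM : 0 ≤ M) (hβ0 : 0 ≤ β) (hβ1 : β ≤ 1) (hfx : f x = 1)
    (hnonneg : ∀ k, 0 ≤ iteratedDeriv k f x)
    (hle : ∀ k, 1 ≤ k → iteratedDeriv k f x ≤ k.factorial * M ^ k * β) (l : ℕ) :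
    ∀ k, 0 ≤ iteratedDeriv k (fun y => f y ^ l) x ∧
      (1 ≤ k → iteratedDeriv k (fun y => f y ^ l) x ≤
        k.factorial * (l : ℝ) ^ k * M ^ k * β) := by
  induction l with
  | zero =>
    intro k
    rcases Nat.eq_zero_or_pos k with rfl | hk
    · simp
    · have h : iteratedDeriv k (fun y => f y ^ 0) x = 0 := by
        simp [iteratedDeriv_const, hk.ne']
      rw [h]
      exact ⟨le_rfl, fun _ => by positivity⟩
  | succ l ih =>
    intro k
    have hmul : iteratedDeriv k (fun y => f y ^ (l + 1)) x =
        ∑ j ∈ range (k + 1), (k.choose j : ℝ) * iteratedDeriv j (fun y => f y ^ l) x *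
          iteratedDeriv (k - j) f x := by
      have hpow : (fun y => f y ^ (l + 1)) = (fun y => f y ^ l) * f := by
        ext y
        simp [pow_succ]
      rw [hpow, iteratedDeriv_mul ((hf.pow l).of_le (by simp)) (hf.of_le (by simp))]
    rw [hmul]
    refine ⟨sum_nonneg fun j _ =>
      mul_nonneg (mul_nonneg (by positivity) (ih j).1) (hnonneg _), fun hk => ?_⟩
    have hterm : ∀ j ∈ range (k + 1), (k.choose j : ℝ) * iteratedDeriv j (fun y => f y ^ l) x *
        iteratedDeriv (k - j) f x ≤
          k.factorial * M ^ k * β * ((l : ℝ) ^ j * 1 ^ (k - j) * k.choose j) := by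
      intro j hj
      have hjk : j ≤ k := by simpa [Nat.lt_succ_iff] using hj
      have hchoose : (1 : ℝ) ≤ k.choose j := by exact_mod_cast Nat.choose_pos hjk
      have hfact : (k.choose j : ℝ) * j.factorial * (k - j).factorial = k.factorial := by
        exact_mod_cast Nat.choose_mul_factorial_mul_factorial hjk
      have hMk : M ^ j * M ^ (k - j) = M ^ k := by rw [← pow_add, Nat.add_sub_cancel' hjk]
      suffices h : (k.choose j : ℝ) * iteratedDeriv j (fun y => f y ^ l) x *
          iteratedDeriv (k - j) f x ≤ k.factorial * M ^ k * β * (l : ℝ) ^ j by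
        refine h.trans ?_
        rw [one_pow, mul_one]
        exact mul_le_mul_of_nonneg_left (le_mul_of_one_le_right (by positivity) hchoose)
          (by positivity)
      rcases Nat.eq_zero_or_pos j with rfl | hj0
      · simpa [hfx] using hle k hk
      rcases hjk.eq_or_lt with rfl | hjlt
      · have h := (ih j).2 hj0
        simp only [Nat.choose_self, Nat.cast_one, one_mul, Nat.sub_self, iteratedDeriv_zero, hfx,
          mul_one]
        linarith
      calc (k.choose j : ℝ) * iteratedDeriv j (fun y => f y ^ l) x * iteratedDeriv (k - j) f x
          ≤ k.choose j * (j.factorial * (l : ℝ) ^ j * M ^ j * β) *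
              ((k - j).factorial * M ^ (k - j) * β) := by
            gcongr
            · exact hnonneg _
            · exact (ih j).2 hj0
            · exact hle _ (by omega)
        _ = k.factorial * M ^ k * β * (l : ℝ) ^ j * β := by
            rw [← hfact, ← hMk]
            ring
        _ ≤ k.factorial * M ^ k * β * (l : ℝ) ^ j := mul_le_of_le_one_right (by positivity) hβ1
    refine (sum_le_sum hterm).trans_eq ?_
    rw [← mul_sum, ← add_pow]
    push_cast
    ring

/-- All the derivatives at `1` of `x ↦ 1 + (x - 1) / (B - A (x - 1))`. -/
theorem iteratedDeriv_moebius_one {A B : ℝ} (hB : 0 < B) (k : ℕ) :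
    iteratedDeriv (k + 1) (fun x => 1 + (x - 1) * (-A * x + (B + A))⁻¹) 1 =
      (k + 1).factorial * A ^ k / B ^ (k + 1) := by
  have hne : -A * 1 + (B + A) ≠ 0 := by
    rw [show -A * 1 + (B + A) = B by ring]
    exact hB.ne'
  have hq : ContDiffAt ℝ (k + 1 : ℕ) (fun x => (-A * x + (B + A))⁻¹) 1 :=
    ContDiffAt.inv (by fun_prop) hne
  have hlin : ∀ j, 2 ≤ j → iteratedDeriv j (fun x : ℝ => x - 1) 1 = 0 := by
    intro j hj
    obtain ⟨i, rfl⟩ := Nat.exists_eq_add_of_le' hj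
    rw [iteratedDeriv_succ', show deriv (fun x : ℝ => x - 1) = fun _ => 1 by ext; simp]
    simp [iteratedDeriv_const]
  rw [iteratedDeriv_const_add (by omega)]
  rw [show (fun x => (x - 1) * (-A * x + (B + A))⁻¹) =
    (fun x => (-A * x + (B + A))⁻¹) * (fun x : ℝ => x - 1) by ext; simp [mul_comm]]
  rw [iteratedDeriv_mul hq (by fun_prop), Finset.sum_range_succ, Finset.sum_range_succ,
    Finset.sum_eq_zero, iteratedDeriv_eq_iterate, iter_deriv_inv_linear]
  · have h1 : iteratedDeriv (k + 1 - k) (fun x : ℝ => x - 1) 1 = 1 := by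
      simp [iteratedDeriv_one]
    rw [h1]
    have h2 : (-A * 1 + (B + A)) = B := by ring
    have h3 : ((-1 : ℝ) ^ k * k.factorial * (-A) ^ k) = k.factorial * A ^ k := by
      rw [mul_right_comm, ← mul_pow]
      simp [mul_comm]
    have h4 : B ^ (-1 - k : ℤ) = (B ^ (k + 1))⁻¹ := by
      rw [← zpow_natCast, ← zpow_neg]
      congr 1
      push_cast
      ring
    simp only [h2, h3, h4]
    simp [Nat.factorial_succ]
    ring
  · intro j hj
    rw [hlin _ (by have := Finset.mem_range.mp hj; omega), mul_zero]

open Filter Topology in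
/-- Near `1` the map `f_v` is a Möbius transformation fixing `1`, with controlled coefficients. -/
theorem fword_eventuallyEq_moebius {ε s : ℝ} {a : ℕ+ → ℝ} (hε0 : 0 < ε) (hε1 : ε < 1 / 2)
    (hs1 : s < 1) (has : ∀ i, a i ≤ s) (v : List ℕ+) (hv : ∀ m ∈ v, 0 < a m) :
    ∃ A B : ℝ, 0 ≤ A ∧ 1 ≤ B ∧ (1 - s) * A ≤ s * (B - 1) ∧
      B⁻¹ = aword a v * ((1 / 2 - ε) / (1 / 2 + ε)) ^ v.length ∧
      fword ε a v =ᶠ[𝓝 1] fun x => 1 + (x - 1) * (-A * x + (B + A))⁻¹ := by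
  induction v with
  | nil =>
    refine ⟨0, 1, le_rfl, le_rfl, by simp, by simp [aword], Eventually.of_forall fun x => ?_⟩
    simp [fword]
  | cons m v ih =>
    obtain ⟨A, B, hA, hB, hAB, hinv, heq⟩ := ih fun i hi => hv i (List.mem_cons_of_mem _ hi)
    have ham : 0 < a m := hv m List.mem_cons_self
    have hd : 0 < 1 / 2 - ε := by linarith
    have hu : 0 < 1 / 2 + ε := by linarith
    obtain ⟨r, hr⟩ : ∃ r, r = (1 / 2 + ε) / ((1 / 2 - ε) * a m) := ⟨_, rfl⟩
    have hrmul : r * ((1 / 2 - ε) * a m) = 1 / 2 + ε := by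
      rw [hr]
      exact div_mul_cancel₀ _ (mul_pos hd ham).ne'
    have hr0 : 0 < r := by rw [hr]; positivity
    have hra : 1 ≤ r * a m := by
      by_contra! h
      nlinarith
    have hrs : 1 ≤ r * s := hra.trans (mul_le_mul_of_nonneg_left (has m) hr0.le)
    have hr1 : 1 ≤ r := by nlinarith
    refine ⟨1 + r * A, r * B, by positivity, by nlinarith, by nlinarith, ?_, ?_⟩
    · have hword : aword a (m :: v) = a m * aword a v := by simp [aword]
      rw [hword, mul_inv, hinv, List.length_cons, pow_succ, hr]
      field_simp
    · have h1 : ∀ᶠ x in 𝓝 (1 : ℝ), -A * x + (B + A) ≠ 0 := by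
        refine ContinuousAt.eventually_ne (by fun_prop) ?_
        intro h
        linarith
      have h2 : ∀ᶠ x in 𝓝 (1 : ℝ), -(1 + r * A) * x + (r * B + (1 + r * A)) ≠ 0 := by
        refine ContinuousAt.eventually_ne (by fun_prop) ?_
        intro h
        nlinarith
      filter_upwards [heq, h1, h2] with x hx hx1 hx2
      have hcons : fword ε a (m :: v) x = fi ε a m (fword ε a v x) := rfl
      rw [hcons, hx, fi, fstep]
      have hinv1 := mul_inv_cancel₀ hx1
      have hinv2 := mul_inv_cancel₀ hx2
      have hden : 1 - (1 / 2 - ε) * (1 - a m + a m * (1 + (x - 1) * (-A * x + (B + A))⁻¹)) =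
          (1 / 2 - ε) * a m * (-(1 + r * A) * x + (r * B + (1 + r * A))) *
            (-A * x + (B + A))⁻¹ := by
        linear_combination (-1) * hrmul - (1 / 2 - ε) * a m * r * hinv1
      have hden_ne : (1 / 2 - ε) * a m * (-(1 + r * A) * x + (r * B + (1 + r * A))) *
          (-A * x + (B + A))⁻¹ ≠ 0 :=
        mul_ne_zero (mul_ne_zero (mul_pos hd ham).ne' hx2) (inv_ne_zero hx1)
      rw [hden, div_eq_iff hden_ne]
      linear_combination (-1) * hrmul - (1 / 2 - ε) * a m * r * hinv1 -
        (1 / 2 - ε) * a m * (-A * x + (B + A))⁻¹ * (x - 1) * hinv2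


/-- For every `p ≥ 1` and `a⁺ ∈ [0,1)` there is a constant `K = K(p, a⁺)` such that for every
`ε ∈ (0,1/2)`, every admissible weight sequence bounded by `a⁺`, every word `v` with letters of
positive weight and every `l ≥ 1`,
`(d^p/dx^p)(f_v)^l (1) ≤ K · l^p · a_v · (d/u)^{|v|}`. -/
theorem stmt6 (p : ℕ) (hp : 1 ≤ p) (aplus : ℝ) (haplus0 : 0 ≤ aplus) (haplus1 : aplus < 1) :
    ∃ K : ℝ, ∀ ε ∈ Set.Ioo (0:ℝ) (1/2),
      ∀ a : ℕ+ → ℝ, (∀ i, 0 ≤ a i) → (∀ i, a i < 1) → HasSum a 1 → (∀ i, a i ≤ aplus) →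
        ∀ v : List ℕ+, (∀ m ∈ v, 0 < a m) → ∀ l : ℕ, 1 ≤ l →
          iteratedDeriv p (fun x => (fword ε a v x) ^ l) 1 ≤
            K * (l : ℝ)^p * aword a v * ((1/2-ε)/(1/2+ε))^v.length := by
  have hM : 0 < 1 - aplus := by linarith
  refine ⟨p.factorial * (1 - aplus)⁻¹ ^ p, fun ε hε a _ _ _ has v hv l _ => ?_⟩
  obtain ⟨A, B, hA, hB, hAB, hinv, heq⟩ :=
    fword_eventuallyEq_moebius hε.1 hε.2 haplus1 has v hv
  have hB0 : 0 < B := by linarith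
  have hAM : A ≤ (1 - aplus)⁻¹ * B := by
    rw [inv_mul_eq_div, le_div_iff₀ hM]
    nlinarith
  have hM1 : 1 ≤ (1 - aplus)⁻¹ := (one_le_inv₀ hM).2 (by linarith)
  have hcont : ContDiffAt ℝ ⊤ (fun x => 1 + (x - 1) * (-A * x + (B + A))⁻¹) 1 := by
    refine contDiffAt_const.add (ContDiffAt.mul (by fun_prop) (ContDiffAt.inv (by fun_prop) ?_))
    intro h
    linarith
  have hpow : (fun x => fword ε a v x ^ l) =ᶠ[nhds 1]
      fun x => (1 + (x - 1) * (-A * x + (B + A))⁻¹) ^ l := by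
    filter_upwards [heq] with x hx
    rw [hx]
  rw [hpow.iteratedDeriv_eq, mul_assoc, ← hinv]
  refine ((iteratedDeriv_pow_le_of_iteratedDeriv_le hcont (inv_pos.2 hM).le (by positivity)
    (inv_le_one_of_one_le₀ hB) (by simp) (fun k => ?_) (fun k hk => ?_) l p).2 hp).trans_eq
      (by ring)
  · cases k with
    | zero => simp
    | succ k =>
      rw [iteratedDeriv_moebius_one hB0]
      positivity
  · obtain ⟨k, rfl⟩ := Nat.exists_eq_add_of_le' hk
    rw [iteratedDeriv_moebius_one hB0, div_eq_mul_inv]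
    have hAk : A ^ k * (B ^ (k + 1))⁻¹ ≤ (1 - aplus)⁻¹ ^ (k + 1) * B⁻¹ :=
      calc A ^ k * (B ^ (k + 1))⁻¹ ≤ ((1 - aplus)⁻¹ * B) ^ k * (B ^ (k + 1))⁻¹ := by gcongr
        _ = (1 - aplus)⁻¹ ^ k * B⁻¹ := by
            rw [mul_pow, pow_succ B]
            field_simp
        _ ≤ (1 - aplus)⁻¹ ^ (k + 1) * B⁻¹ := by
            gcongr ?_ * B⁻¹
            exact pow_le_pow_right₀ hM1 k.le_succ
    rw [mul_assoc, mul_assoc]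
    exact mul_le_mul_of_nonneg_left hAk (by positivity)
end

section
/- For every s > 0 and every λ ∈ ℝ: the characteristic function of ρ_ε satisfies φ_ε(θ) := ∑_{k=−1}^∞ u_ε d_ε^{k+1} e^{iθk} = u_ε e^{−iθ}/(1 − d_ε e^{iθ}) for all θ ∈ ℝ, and lim_{ε→0+} ( φ_ε(λε) )^{⌊s/(2ε²)⌋} = exp( −sλ²/2 − 2isλ ). -/
open Filter

/-- The characteristic function `φ_ε(θ) = ∑_{k=−1}^∞ u_ε d_ε^{k+1} e^{iθk}`, written with the
index shifted to `j = k + 1 ∈ ℕ`. -/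
noncomputable def phi (ε : ℝ) (θ : ℝ) : ℂ :=
  ∑' j : ℕ, ((1/2 + ε : ℝ) : ℂ) * ((1/2 - ε : ℝ) : ℂ)^j *
    Complex.exp (Complex.I * (θ : ℂ) * ((j : ℂ) - 1))

open Topology in
/-- If `z → 0` and `n * z → t` along a filter, then `(1 + z) ^ n → exp t`. -/
theorem tendsto_one_add_pow_exp_of_tendsto_mul_s9 {α : Type*} {l : Filter α} {z : α → ℂ} {n : α → ℕ}
    {t : ℂ} (hz : Tendsto z l (𝓝 0)) (hn : Tendsto (fun a => (n a : ℂ) * z a) l (𝓝 t)) :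
    Tendsto (fun a => (1 + z a) ^ n a) l (𝓝 (Complex.exp t)) := by
  have hd : HasDerivAt (fun w : ℂ => Complex.log (1 + w)) 1 0 := by
    simpa using ((hasDerivAt_id (0 : ℂ)).const_add 1).clog (by simp)
  have hq : Tendsto (dslope (fun w : ℂ => Complex.log (1 + w)) 0) (𝓝 0) (𝓝 1) := by
    have := (continuousAt_dslope_same.2 hd.differentiableAt).tendsto
    rwa [dslope_same, hd.deriv] at this
  have hlog : ∀ w : ℂ,
      w * dslope (fun w : ℂ => Complex.log (1 + w)) 0 w = Complex.log (1 + w) := fun w => by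
    simpa using sub_smul_dslope (fun w : ℂ => Complex.log (1 + w)) 0 w
  have hlim := hn.mul (hq.comp hz)
  rw [mul_one] at hlim
  refine ((Complex.continuous_exp.tendsto t).comp hlim).congr' ?_
  filter_upwards [hz.eventually_ne (show (0 : ℂ) ≠ -1 by simp)] with a ha
  have hne : 1 + z a ≠ 0 := fun h => ha (eq_neg_of_add_eq_zero_right h)
  simp only [Function.comp_apply]
  rw [mul_assoc, hlog, Complex.exp_nat_mul, Complex.exp_log hne]

open Topology in
theorem tendsto_sin_mul_div (a : ℝ) :
    Tendsto (fun x : ℝ => Real.sin (a * x) / x) (𝓝[≠] 0) (𝓝 a) := by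
  have h : HasDerivAt (fun x : ℝ => Real.sin (a * x)) a 0 := by
    simpa using ((hasDerivAt_id (0 : ℝ)).const_mul a).sin
  refine h.tendsto_slope.congr fun x => ?_
  simp [slope_def_field]

open Topology in
theorem tendsto_floor_div_sq_mul_sq {s : ℝ} (hs : 0 < s) :
    Tendsto (fun x : ℝ => (⌊s / (2 * x ^ 2)⌋₊ : ℝ) * x ^ 2) (𝓝[≠] 0) (𝓝 (s / 2)) := by
  have hsq : Tendsto (fun x : ℝ => 2 / s * x ^ 2) (𝓝[≠] 0) (𝓝[>] 0) := by
    refine tendsto_nhdsWithin_iff.2 ⟨?_, ?_⟩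
    · have : Continuous fun x : ℝ => 2 / s * x ^ 2 := by fun_prop
      simpa using (this.tendsto 0).mono_left nhdsWithin_le_nhds
    · filter_upwards [self_mem_nhdsWithin] with x hx
      have : x ≠ 0 := hx
      exact Set.mem_Ioi.2 (by positivity)
  have h := ((tendsto_nat_floor_div_atTop (R := ℝ)).comp
    (tendsto_inv_nhdsGT_zero.comp hsq)).mul_const (s / 2)
  rw [one_mul] at h
  refine h.congr' ?_
  filter_upwards [self_mem_nhdsWithin] with x hx
  have hx' : x ≠ 0 := hx
  have e : (2 / s * x ^ 2)⁻¹ = s / (2 * x ^ 2) := by field_simp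
  simp only [Function.comp_apply, e]
  field_simp

theorem norm_mul_exp_I_mul_lt_one {ε : ℝ} (hε : ε ∈ Set.Ioo (0 : ℝ) (1 / 2)) (θ : ℝ) :
    ‖((1 / 2 - ε : ℝ) : ℂ) * Complex.exp (Complex.I * (θ : ℂ))‖ < 1 := by
  rw [norm_mul, mul_comm Complex.I, Complex.norm_exp_ofReal_mul_I, Complex.norm_real,
    Real.norm_eq_abs, abs_of_pos (by linarith [hε.2])]
  linarith [hε.1]

theorem hasSum_phi {ε : ℝ} (hε : ε ∈ Set.Ioo (0 : ℝ) (1 / 2)) (θ : ℝ) :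
    HasSum (fun j : ℕ => ((1/2 + ε : ℝ) : ℂ) * ((1/2 - ε : ℝ) : ℂ)^j *
          Complex.exp (Complex.I * (θ : ℂ) * ((j : ℂ) - 1)))
        (((1/2 + ε : ℝ) : ℂ) * Complex.exp (-(Complex.I * (θ : ℂ))) /
          (1 - ((1/2 - ε : ℝ) : ℂ) * Complex.exp (Complex.I * (θ : ℂ)))) := by
  rw [div_eq_mul_inv]
  refine ((hasSum_geometric_of_norm_lt_one (norm_mul_exp_I_mul_lt_one hε θ)).mul_left _).congr_fun ?_
  intro j
  rw [mul_pow, ← Complex.exp_nat_mul,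
    show Complex.I * (θ : ℂ) * ((j : ℂ) - 1) = -(Complex.I * θ) + j * (Complex.I * θ) by ring,
    Complex.exp_add]
  ring_nf

/-- `φ_ε(θ) - 1 = (cos θ - 1 - 2iε sin θ) / (1 - d_ε e^{iθ})`, with `cos θ - 1 = -2 sin² (θ/2)`. -/
theorem phi_eq_one_add {ε : ℝ} (hε : ε ∈ Set.Ioo (0 : ℝ) (1 / 2)) (θ : ℝ) :
    phi ε θ = 1 + (-2 * (Real.sin (θ / 2) : ℂ) ^ 2 - 2 * Complex.I * ε * (Real.sin θ : ℂ)) /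
      (1 - ((1 / 2 - ε : ℝ) : ℂ) * Complex.exp (Complex.I * (θ : ℂ))) := by
  have hD : 1 - ((1 / 2 - ε : ℝ) : ℂ) * Complex.exp (Complex.I * (θ : ℂ)) ≠ 0 := by
    intro h
    have hlt := norm_mul_exp_I_mul_lt_one hε θ
    rw [← sub_eq_zero.1 h, norm_one] at hlt
    exact lt_irrefl _ hlt
  have hcos : (-2 * (Real.sin (θ / 2) : ℂ) ^ 2) = Complex.cos θ - 1 := by
    have h : -2 * Real.sin (θ / 2) ^ 2 = Real.cos θ - 1 := by
      have h1 := Real.cos_sq (θ / 2)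
      have h2 := Real.sin_sq_add_cos_sq (θ / 2)
      rw [mul_div_cancel₀ θ two_ne_zero] at h1
      linarith
    exact_mod_cast congrArg (fun x : ℝ => (x : ℂ)) h
  have hexp : Complex.exp (Complex.I * θ) = Complex.cos θ + Complex.sin θ * Complex.I := by
    rw [mul_comm, Complex.exp_mul_I]
  have hexp' : Complex.exp (-(Complex.I * θ)) = Complex.cos θ - Complex.sin θ * Complex.I := by
    rw [mul_comm, ← neg_mul, Complex.exp_mul_I, Complex.cos_neg, Complex.sin_neg]
    ring
  have hphi : phi ε θ = _ := (hasSum_phi hε θ).tsum_eq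
  rw [hphi, hcos, div_eq_iff hD, add_mul, div_mul_cancel₀ _ hD, hexp, hexp', Complex.ofReal_sin]
  push_cast
  ring

/-- For every `s > 0` and `λ ∈ ℝ`: the characteristic function of `ρ_ε` satisfies
`φ_ε(θ) = u_ε e^{−iθ}/(1 − d_ε e^{iθ})` for all `θ`, and
`lim_{ε→0+} (φ_ε(λε))^{⌊s/(2ε²)⌋} = exp(−sλ²/2 − 2isλ)`. -/
theorem stmt9 (s : ℝ) (hs : 0 < s) (lam : ℝ) :
    (∀ ε ∈ Set.Ioo (0:ℝ) (1/2), ∀ θ : ℝ,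
      HasSum (fun j : ℕ => ((1/2 + ε : ℝ) : ℂ) * ((1/2 - ε : ℝ) : ℂ)^j *
          Complex.exp (Complex.I * (θ : ℂ) * ((j : ℂ) - 1)))
        (((1/2 + ε : ℝ) : ℂ) * Complex.exp (-(Complex.I * (θ : ℂ))) /
          (1 - ((1/2 - ε : ℝ) : ℂ) * Complex.exp (Complex.I * (θ : ℂ))))) ∧
    Tendsto (fun ε : ℝ => (phi ε (lam * ε)) ^ ⌊s / (2 * ε^2)⌋₊)
      (nhdsWithin 0 (Set.Ioo 0 (1/2)))
      (nhds (Complex.exp (-(s * lam^2) / 2 - 2 * Complex.I * (s : ℂ) * (lam : ℂ)))) := by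
  refine ⟨fun ε hε θ => hasSum_phi hε θ, ?_⟩
  set l := nhdsWithin (0 : ℝ) (Set.Ioo 0 (1 / 2)) with hl
  have hne : l ≤ nhdsWithin 0 {0}ᶜ := nhdsWithin_mono 0 fun x hx => hx.1.ne'
  have hmem : ∀ᶠ ε in l, ε ∈ Set.Ioo (0 : ℝ) (1 / 2) := self_mem_nhdsWithin
  have hsin := ((tendsto_sin_mul_div lam).mono_left hne).ofReal
  have hsin2 := ((tendsto_sin_mul_div (lam / 2)).mono_left hne).ofReal
  have hfloor := ((tendsto_floor_div_sq_mul_sq hs).mono_left hne).ofReal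
  have hsq : Tendsto (fun ε : ℝ => (ε : ℂ) ^ 2) l (nhds 0) := by
    have : Continuous fun ε : ℝ => (ε : ℂ) ^ 2 := by fun_prop
    simpa using (this.tendsto 0).mono_left (nhdsWithin_le_nhds (s := Set.Ioo 0 (1 / 2)))
  have hden : Tendsto (fun ε : ℝ => 1 - ((1 / 2 - ε : ℝ) : ℂ) *
      Complex.exp (Complex.I * ((lam * ε : ℝ) : ℂ))) l (nhds (1 / 2)) := by
    have hc : Continuous fun ε : ℝ => 1 - ((1 / 2 - ε : ℝ) : ℂ) *
      Complex.exp (Complex.I * ((lam * ε : ℝ) : ℂ)) := by fun_prop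
    convert (hc.tendsto 0).mono_left (nhdsWithin_le_nhds (s := Set.Ioo 0 (1 / 2))) using 2
    norm_num
  have hratio := (((hsin2.pow 2).const_mul (-2)).sub (hsin.const_mul (2 * Complex.I))).div hden
    (by norm_num)
  set z : ℝ → ℂ := fun ε => (-2 * (Real.sin (lam * ε / 2) : ℂ) ^ 2 -
    2 * Complex.I * ε * (Real.sin (lam * ε) : ℂ)) /
      (1 - ((1 / 2 - ε : ℝ) : ℂ) * Complex.exp (Complex.I * ((lam * ε : ℝ) : ℂ))) with hzdef
  have hz : ∀ ε : ℝ, ε ≠ 0 → z ε = (ε : ℂ) ^ 2 *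
      ((-2 * ((Real.sin (lam / 2 * ε) / ε : ℝ) : ℂ) ^ 2 -
        2 * Complex.I * ((Real.sin (lam * ε) / ε : ℝ) : ℂ)) /
        (1 - ((1 / 2 - ε : ℝ) : ℂ) * Complex.exp (Complex.I * ((lam * ε : ℝ) : ℂ)))) := by
    intro ε hε
    have hε' : (ε : ℂ) ≠ 0 := mod_cast hε
    rw [← mul_div_assoc, show lam / 2 * ε = lam * ε / 2 by ring, hzdef]
    rw [Complex.ofReal_div, Complex.ofReal_div]
    field_simp
  have hz0 : Tendsto z l (nhds 0) := by
    have h := hsq.mul hratio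
    rw [zero_mul] at h
    refine h.congr' ?_
    filter_upwards [hmem] with ε hε
    exact (hz ε hε.1.ne').symm
  have hnz : Tendsto (fun ε => (⌊s / (2 * ε ^ 2)⌋₊ : ℂ) * z ε) l
      (nhds (-(s * lam ^ 2) / 2 - 2 * Complex.I * (s : ℂ) * (lam : ℂ))) := by
    have h := hfloor.mul hratio
    have hval : ((s / 2 : ℝ) : ℂ) * ((-2 * ((lam / 2 : ℝ) : ℂ) ^ 2 - 2 * Complex.I * lam) /
        (1 / 2)) = -(s * lam ^ 2) / 2 - 2 * Complex.I * (s : ℂ) * (lam : ℂ) := by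
      push_cast
      ring
    rw [← hval]
    refine h.congr' ?_
    filter_upwards [hmem] with ε hε
    rw [hz ε hε.1.ne', ← mul_assoc]
    push_cast
    rfl
  refine (tendsto_one_add_pow_exp_of_tendsto_mul_s9 hz0 hnz).congr' ?_
  filter_upwards [hmem] with ε hε
  rw [phi_eq_one_add hε]
end

section
/- Define γ_ε > 0 by 1/γ_ε = (1 − d/u) · ∑_{v∈𝕌} (1 − f_v(0)) (the sum is finite and at least 1). Then for every integer l ≥ 1 the family ( l·f_v'(1) − γ_ε (1 − f_v(0)^l) )_{v∈𝕌} is absolutely summable and 0 ≤ ∑_{v∈𝕌} [ l·f_v'(1) − γ_ε (1 − f_v(0)^l) ] ≤ γ_ε · l(l−1) / (2(1 − a₊)). -/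
theorem hasSum_prod_fin {ι : Type*} {b : ι → ℝ} {r : ℝ} (hb : ∀ i, 0 ≤ b i) (h : HasSum b r)
    (n : ℕ) : HasSum (fun x : Fin n → ι => ∏ k, b (x k)) (r ^ n) := by
  induction n with
  | zero => simp
  | succ n ih =>
    have hnn : (0 : (Fin n → ι) → ℝ) ≤ fun x => ∏ k, b (x k) :=
      fun x => Finset.prod_nonneg fun k _ => hb _
    have hprod := (h.summable.mul_of_nonneg ih.summable hb hnn)
    have hmul := h.mul ih hprod
    rw [← (Fin.consEquiv fun _ : Fin (n + 1) => ι).hasSum_iff, pow_succ']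
    refine hmul.congr_fun fun x => ?_
    simp [Fin.consEquiv, Fin.prod_univ_succ]

theorem hasSum_prod_list {ι : Type*} {b : ι → ℝ} {r : ℝ} (hb : ∀ i, 0 ≤ b i) (h : HasSum b r)
    (hr : r < 1) : HasSum (fun v : List ι => (v.map b).prod) (1 - r)⁻¹ := by
  have hr0 : 0 ≤ r := h.nonneg hb
  have hgeom := hasSum_geometric_of_lt_one hr0 hr
  have hlevel := hasSum_prod_fin hb h
  rw [← (List.equivSigmaTuple (α := ι)).symm.hasSum_iff]
  have heq : ((fun v : List ι => (v.map b).prod) ∘ (List.equivSigmaTuple (α := ι)).symm) =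
      fun x : (n : ℕ) × (Fin n → ι) => ∏ k, b (x.2 k) := by
    ext ⟨n, x⟩
    simp [List.equivSigmaTuple, List.map_ofFn, List.prod_ofFn]
  rw [heq]
  refine HasSum.sigma_of_hasSum hgeom hlevel ?_
  refine (summable_sigma_of_nonneg fun x => Finset.prod_nonneg fun k _ => hb _).2
    ⟨fun n => (hlevel n).summable, ?_⟩
  simpa only [(hlevel _).tsum_eq] using hgeom.summable

theorem one_sub_pow_le_quadratic {p : ℝ} (h0 : 0 ≤ p) (h1 : p ≤ 1) (l : ℕ) :
    (1 - p) ^ l ≤ 1 - l * p + l * (l - 1) / 2 * p ^ 2 := by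
  induction l with
  | zero => simp
  | succ n ih =>
    have hn : (0 : ℝ) ≤ n * (n - 1) := by
      rcases n with _ | n
      · simp
      · push_cast
        have : (0 : ℝ) ≤ n := n.cast_nonneg
        nlinarith
    have hmul := mul_le_mul_of_nonneg_right ih (sub_nonneg.2 h1)
    have hcube := mul_nonneg hn (pow_nonneg h0 3)
    rw [pow_succ]
    push_cast
    nlinarith

section FWord

variable {ε : ℝ} {a : ℕ+ → ℝ}

theorem one_sub_fi (hε : ε ∈ Set.Ioo (0 : ℝ) (1 / 2)) (ha0 : ∀ i, 0 ≤ a i) (i : ℕ+) {x : ℝ}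
    (hx : x ≤ 1) :
    1 - fi ε a i x = (1 / 2 - ε) / (1 / 2 + ε) * a i * (1 - x) /
      (1 + (1 / 2 - ε) / (1 / 2 + ε) * a i * (1 - x)) := by
  obtain ⟨h0, h1⟩ := hε
  have hu : 0 < 1 / 2 + ε := by linarith
  have hs : 0 ≤ (1 / 2 - ε) * (a i * (1 - x)) :=
    mul_nonneg (by linarith) (mul_nonneg (ha0 i) (by linarith))
  have hden : 1 - (1 / 2 - ε) * (1 - a i + a i * x) =
      1 / 2 + ε + (1 / 2 - ε) * (a i * (1 - x)) := by ring
  have hden' : 1 + (1 / 2 - ε) / (1 / 2 + ε) * a i * (1 - x) =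
      (1 / 2 + ε + (1 / 2 - ε) * (a i * (1 - x))) / (1 / 2 + ε) := by
    field_simp
  have hpos : 0 < 1 / 2 + ε + (1 / 2 - ε) * (a i * (1 - x)) := by linarith
  rw [fi, fstep, hden, hden', one_sub_div hpos.ne', div_div_eq_mul_div]
  congr 1
  field_simp
  ring

theorem fword_cons (i : ℕ+) (v : List ℕ+) : fword ε a (i :: v) = fi ε a i ∘ fword ε a v := rfl

theorem one_sub_fword_zero_bounds (hε : ε ∈ Set.Ioo (0 : ℝ) (1 / 2)) (ha0 : ∀ i, 0 ≤ a i)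
    (v : List ℕ+) :
    0 ≤ 1 - fword ε a v 0 ∧ 1 - fword ε a v 0 ≤ 1 ∧
      1 - fword ε a v 0 ≤ (v.map fun i => (1 / 2 - ε) / (1 / 2 + ε) * a i).prod := by
  induction v with
  | nil => simp [fword]
  | cons i v ih =>
    obtain ⟨ih0, -, ih2⟩ := ih
    have hq : 0 ≤ (1 / 2 - ε) / (1 / 2 + ε) * a i :=
      mul_nonneg (div_nonneg (by linarith [hε.2]) (by linarith [hε.1])) (ha0 i)
    have hs := mul_nonneg hq ih0
    rw [fword_cons, Function.comp_apply, one_sub_fi hε ha0 i (sub_nonneg.1 ih0), List.map_cons,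
      List.prod_cons]
    refine ⟨by positivity, (div_le_one (by positivity)).2 (by linarith), ?_⟩
    exact (div_le_self hs (by linarith)).trans (mul_le_mul_of_nonneg_left ih2 hq)

theorem fi_one (hε : ε ∈ Set.Ioo (0 : ℝ) (1 / 2)) (ha0 : ∀ i, 0 ≤ a i) (i : ℕ+) :
    fi ε a i 1 = 1 := by
  have h := one_sub_fi hε ha0 i le_rfl
  simp only [sub_self, mul_zero, zero_div] at h
  linarith

theorem hasDerivAt_fi_one (hε : 0 < ε) (i : ℕ+) :
    HasDerivAt (fi ε a i) ((1 / 2 - ε) / (1 / 2 + ε) * a i) 1 := by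
  have hu : 1 / 2 + ε ≠ 0 := by linarith
  have hval : 1 - (1 / 2 - ε) * (1 - a i + a i * 1) = 1 / 2 + ε := by ring
  have hinner : HasDerivAt (fun x : ℝ => 1 - (1 / 2 - ε) * (1 - a i + a i * x))
      (-((1 / 2 - ε) * (a i * 1))) 1 :=
    ((((hasDerivAt_id (1 : ℝ)).const_mul (a i)).const_add (1 - a i)).const_mul
      (1 / 2 - ε)).const_sub 1
  have h := (hasDerivAt_const (1 : ℝ) (1 / 2 + ε)).div hinner (by rwa [hval])
  rw [hval] at h
  refine HasDerivAt.congr_deriv (f := fi ε a i) h ?_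
  field_simp
  ring

theorem fword_one_and_hasDerivAt (hε : ε ∈ Set.Ioo (0 : ℝ) (1 / 2)) (ha0 : ∀ i, 0 ≤ a i)
    (v : List ℕ+) :
    fword ε a v 1 = 1 ∧
      HasDerivAt (fword ε a v) (v.map fun i => (1 / 2 - ε) / (1 / 2 + ε) * a i).prod 1 := by
  induction v with
  | nil => exact ⟨rfl, by simpa [fword] using hasDerivAt_id (1 : ℝ)⟩
  | cons i v ih =>
    refine ⟨by rw [fword_cons, Function.comp_apply, ih.1, fi_one hε ha0], ?_⟩
    rw [fword_cons, List.map_cons, List.prod_cons]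
    exact HasDerivAt.comp 1 (by rw [ih.1]; exact hasDerivAt_fi_one hε.1 i) ih.2

end FWord

/-- With `γ_ε > 0` defined by `1/γ_ε = (1 − d/u) ∑_{v∈𝕌} (1 − f_v(0))` (the defining sum is
finite and at least `1`): for every `l ≥ 1` the family `(l·f_v'(1) − γ_ε(1 − f_v(0)^l))_{v∈𝕌}`
is absolutely summable, and its sum lies in `[0, γ_ε l(l−1)/(2(1 − a₊))]`. -/
theorem stmt13 (ε : ℝ) (hε : ε ∈ Set.Ioo (0:ℝ) (1/2))
    (a : ℕ+ → ℝ) (ha0 : ∀ i, 0 ≤ a i) (ha1 : ∀ i, a i < 1) (hsum : HasSum a 1)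
    (haplus : (⨆ i, a i) < 1)
    (γε : ℝ) (hγpos : 0 < γε)
    (hγ : 1 / γε = (1 - (1/2-ε)/(1/2+ε)) * ∑' v : List ℕ+, (1 - fword ε a v 0))
    (l : ℕ) (hl : 1 ≤ l) :
    Summable (fun v : List ℕ+ => 1 - fword ε a v 0) ∧
    1 ≤ ∑' v : List ℕ+, (1 - fword ε a v 0) ∧
    Summable (fun v : List ℕ+ =>
      |(l : ℝ) * deriv (fword ε a v) 1 - γε * (1 - (fword ε a v 0) ^ l)|) ∧
    0 ≤ ∑' v : List ℕ+, ((l : ℝ) * deriv (fword ε a v) 1 - γε * (1 - (fword ε a v 0) ^ l)) ∧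
    ∑' v : List ℕ+, ((l : ℝ) * deriv (fword ε a v) 1 - γε * (1 - (fword ε a v 0) ^ l)) ≤
      γε * (l : ℝ) * ((l : ℝ) - 1) / (2 * (1 - (⨆ i, a i))) := by
  set q : ℝ := (1/2-ε)/(1/2+ε) with hq
  have hu : 0 < 1/2 + ε := by linarith [hε.1]
  have hq0 : 0 ≤ q := div_nonneg (by linarith [hε.2]) hu.le
  have hq1 : q < 1 := (div_lt_one hu).2 (by linarith [hε.1])
  have hb0 : ∀ i, 0 ≤ q * a i := fun i => mul_nonneg hq0 (ha0 i)
  have hw : HasSum (fun v : List ℕ+ => (v.map fun i => q * a i).prod) (1 - q)⁻¹ :=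
    hasSum_prod_list hb0 (by simpa using hsum.mul_left q) hq1
  set p : List ℕ+ → ℝ := fun v => 1 - fword ε a v 0 with hp
  have hp0 : ∀ v, 0 ≤ p v := fun v => (one_sub_fword_zero_bounds hε ha0 v).1
  have hp1 : ∀ v, p v ≤ 1 := fun v => (one_sub_fword_zero_bounds hε ha0 v).2.1
  have hpw : ∀ v, p v ≤ (v.map fun i => q * a i).prod :=
    fun v => (one_sub_fword_zero_bounds hε ha0 v).2.2
  have hpsum : Summable p := .of_nonneg_of_le hp0 hpw hw.summable
  have hf : ∀ v, fword ε a v 0 = 1 - p v := fun v => by simp [hp]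
  have hderiv : ∀ v, deriv (fword ε a v) 1 = (v.map fun i => q * a i).prod :=
    fun v => (fword_one_and_hasDerivAt hε ha0 v).2.deriv
  -- The sum of the squares is controlled by `∑ (q a_i)² ≤ a₊`.
  have hbdd : BddAbove (Set.range a) := ⟨1, by rintro _ ⟨i, rfl⟩; exact (ha1 i).le⟩
  have hsq_le : ∀ i, (q * a i) ^ 2 ≤ (⨆ i, a i) * a i := fun i => by
    have h1 : q ^ 2 ≤ 1 := pow_le_one₀ hq0 hq1.le
    have h2 := mul_le_mul_of_nonneg_right (le_ciSup hbdd i) (ha0 i)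
    nlinarith [mul_le_mul_of_nonneg_right h1 (sq_nonneg (a i))]
  have hmaj : HasSum (fun i => (⨆ i, a i) * a i) (⨆ i, a i) := by
    simpa using hsum.mul_left (⨆ i, a i)
  have hsq : Summable fun i => (q * a i) ^ 2 :=
    .of_nonneg_of_le (fun i => sq_nonneg _) hsq_le hmaj.summable
  have hr : ∑' i, (q * a i) ^ 2 ≤ ⨆ i, a i := hasSum_le hsq_le hsq.hasSum hmaj
  have hw2 := hasSum_prod_list (fun i => sq_nonneg (q * a i)) hsq.hasSum (hr.trans_lt haplus)
  have hp2w : ∀ v, p v ^ 2 ≤ (v.map fun i => (q * a i) ^ 2).prod := fun v => by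
    have h := Multiset.prod_map_pow (m := (v : Multiset ℕ+)) (f := fun i => q * a i) (n := 2)
    simp only [Multiset.map_coe, Multiset.prod_coe] at h
    rw [h]
    exact pow_le_pow_left₀ (hp0 v) (hpw v) 2
  have hp2sum : Summable fun v => p v ^ 2 :=
    .of_nonneg_of_le (fun v => sq_nonneg _) hp2w hw2.summable
  have hp2 : ∑' v, p v ^ 2 ≤ (1 - ⨆ i, a i)⁻¹ :=
    (hasSum_le hp2w hp2sum.hasSum hw2).trans
      (inv_anti₀ (by linarith) (by linarith))
  -- Replacing `f_v'(1)` by `γ p_v` does not change the total, by the choice of `γ`.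
  have hγw : (1 - q)⁻¹ = γε * ∑' v, p v := by
    have h1 : 1 - q ≠ 0 := by linarith
    field_simp at hγ ⊢
    linarith
  have hdiff : HasSum (fun v : List ℕ+ => (l : ℝ) * ((v.map fun i => q * a i).prod - γε * p v))
      0 := by
    simpa [hγw] using (hw.sub (hpsum.hasSum.mul_left γε)).mul_left (l : ℝ)
  have herr0 : ∀ v, 0 ≤ l * p v - (1 - (1 - p v) ^ l) := fun v => by
    have := one_add_mul_le_pow (a := -p v) (by linarith [hp1 v]) l
    rw [← sub_eq_add_neg] at this
    linarith
  have herr_le : ∀ v, l * p v - (1 - (1 - p v) ^ l) ≤ (l * (l - 1) / 2 : ℝ) * p v ^ 2 :=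
    fun v => by linarith [one_sub_pow_le_quadratic (hp0 v) (hp1 v) l]
  have herr : Summable fun v => l * p v - (1 - (1 - p v) ^ l) :=
    .of_nonneg_of_le herr0 herr_le (hp2sum.mul_left _)
  have htotal : HasSum (fun v : List ℕ+ =>
      (l : ℝ) * deriv (fword ε a v) 1 - γε * (1 - (fword ε a v 0) ^ l))
      (γε * ∑' v, (l * p v - (1 - (1 - p v) ^ l))) := by
    rw [← zero_add (γε * _)]
    refine (hdiff.add (herr.hasSum.mul_left γε)).congr_fun fun v => ?_
    rw [hderiv, hf]
    ring
  refine ⟨hpsum, ?_, htotal.summable.abs, ?_, ?_⟩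
  · have h : p [] = 1 := by simp [hp, fword]
    exact h.symm.le.trans (hpsum.le_tsum [] fun v _ => hp0 v)
  · rw [htotal.tsum_eq]
    exact mul_nonneg hγpos.le (tsum_nonneg herr0)
  · rw [htotal.tsum_eq]
    have hl' : (0 : ℝ) ≤ l * (l - 1) / 2 := by
      have : (1 : ℝ) ≤ l := by exact_mod_cast hl
      have : (0 : ℝ) ≤ l - 1 := by linarith
      positivity
    calc γε * ∑' v, (l * p v - (1 - (1 - p v) ^ l))
        ≤ γε * ((l * (l - 1) / 2) * (1 - ⨆ i, a i)⁻¹) := by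
          refine mul_le_mul_of_nonneg_left ?_ hγpos.le
          refine (hasSum_le herr_le herr.hasSum (hp2sum.hasSum.mul_left _)).trans ?_
          exact mul_le_mul_of_nonneg_left hp2 hl'
      _ = γε * l * (l - 1) / (2 * (1 - ⨆ i, a i)) := by
          have : 1 - (⨆ i, a i) ≠ 0 := by linarith
          field_simp
end

section
/- The family ((1 − f_v(0))²)_{v∈𝕌} is summable and ∑_{v ∈ 𝕌} (1 − f_v(0))² ≤ 1/(1 − a₊). -/
open scoped ENNReal in
theorem ENNReal.tsum_fin_pi_prod {ι : Type*} (b : ι → ℝ≥0∞) (n : ℕ) :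
    ∑' v : Fin n → ι, ∏ i, b (v i) = (∑' i, b i) ^ n := by
  induction n with
  | zero => simp
  | succ n ih =>
    rw [← (Fin.consEquiv fun _ : Fin (n + 1) => ι).tsum_eq, ENNReal.tsum_prod', pow_succ', ← ih,
      ← ENNReal.tsum_mul_right]
    refine tsum_congr fun i => ?_
    rw [← ENNReal.tsum_mul_left]
    exact tsum_congr fun v => by simp [Fin.consEquiv, Fin.prod_univ_succ]

open scoped ENNReal in
/-- Weights multiplicative over the letters of a word sum to a geometric series. -/
theorem ENNReal.tsum_list_map_prod {ι : Type*} (b : ι → ℝ≥0∞) :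
    ∑' v : List ι, (v.map b).prod = (1 - ∑' i, b i)⁻¹ := by
  rw [← List.equivSigmaTuple.symm.tsum_eq, ENNReal.tsum_sigma', ← ENNReal.tsum_geometric]
  refine tsum_congr fun n => ?_
  rw [← ENNReal.tsum_fin_pi_prod]
  refine tsum_congr fun v => ?_
  simp [List.equivSigmaTuple, List.map_ofFn, List.prod_ofFn]

/-- Sums over words of nonnegative real weights multiplicative in the letters. -/
theorem summable_list_map_prod_and_tsum_le {ι : Type*} {b : ι → ℝ} (hb : ∀ i, 0 ≤ b i)
    (hs : Summable b) {s : ℝ} (hle : ∑' i, b i ≤ s) (h_lt : s < 1) :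
    Summable (fun v : List ι => (v.map b).prod) ∧
      ∑' v : List ι, (v.map b).prod ≤ 1 / (1 - s) := by
  have hnn (v : List ι) : 0 ≤ (v.map b).prod :=
    List.prod_nonneg (by simpa using fun i _ => hb i)
  have hmap (v : List ι) :
      (v.map fun i => ENNReal.ofReal (b i)).prod = ENNReal.ofReal (v.map b).prod := by
    induction v with
    | nil => simp
    | cons i v ih => simp [ih, ENNReal.ofReal_mul (hb i)]
  have key : ∑' v : List ι, ENNReal.ofReal (v.map b).prod ≤ ENNReal.ofReal (1 / (1 - s)) := by
    simp_rw [← hmap]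
    rw [ENNReal.tsum_list_map_prod, ← ENNReal.ofReal_tsum_of_nonneg hb hs, one_div,
      ENNReal.ofReal_inv_of_pos (by linarith), ENNReal.ofReal_sub _ ((tsum_nonneg hb).trans hle),
      ENNReal.ofReal_one]
    gcongr
  have hsum : Summable (fun v : List ι => (v.map b).prod) := by
    have := ENNReal.summable_toReal (key.trans_lt ENNReal.ofReal_lt_top).ne
    simpa only [ENNReal.toReal_ofReal (hnn _)] using this
  refine ⟨hsum, ?_⟩
  rw [← ENNReal.ofReal_tsum_of_nonneg hnn hsum] at key
  exact (ENNReal.ofReal_le_ofReal_iff (by rw [one_div, inv_nonneg]; linarith)).1 key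

theorem one_sub_fi_mem_Icc {ε : ℝ} (hε : ε ∈ Set.Ioo (0 : ℝ) (1 / 2)) {a : ℕ+ → ℝ} {i : ℕ+}
    (hi : 0 ≤ a i) {x : ℝ} (hx : x ≤ 1) : 1 - fi ε a i x ∈ Set.Icc 0 (a i * (1 - x)) := by
  obtain ⟨h0, h1⟩ := hε
  have hy : 0 ≤ a i * (1 - x) := mul_nonneg hi (by linarith)
  have hdy : 0 ≤ (1 / 2 - ε) * (a i * (1 - x)) := mul_nonneg (by linarith) hy
  have hden : 1 - (1 / 2 - ε) * (1 - a i + a i * x)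
      = 1 / 2 + ε + (1 / 2 - ε) * (a i * (1 - x)) := by ring
  have heq : 1 - fi ε a i x = (1 / 2 - ε) * (a i * (1 - x))
      / (1 / 2 + ε + (1 / 2 - ε) * (a i * (1 - x))) := by
    rw [fi, fstep, hden, eq_div_iff (by linarith), sub_mul, div_mul_cancel₀ _ (by linarith)]
    ring
  rw [heq]
  refine ⟨div_nonneg hdy (by linarith), ?_⟩
  rw [div_le_iff₀ (by linarith)]
  nlinarith [mul_nonneg hy h0.le, mul_nonneg hy hdy]

theorem one_sub_fword_zero_mem_Icc {ε : ℝ} (hε : ε ∈ Set.Ioo (0 : ℝ) (1 / 2)) {a : ℕ+ → ℝ}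
    (ha : ∀ i, 0 ≤ a i) (v : List ℕ+) : 1 - fword ε a v 0 ∈ Set.Icc 0 (aword a v) := by
  induction v with
  | nil => simp [fword, aword]
  | cons i v ih =>
    have h := one_sub_fi_mem_Icc hε (ha i) (sub_nonneg.1 ih.1)
    have hw : aword a (i :: v) = a i * aword a v := by simp [aword]
    rw [hw]
    exact ⟨h.1, h.2.trans (mul_le_mul_of_nonneg_left ih.2 (ha i))⟩

/-- The family `((1 − f_v(0))²)_{v∈𝕌}` is summable and its sum is at most `1/(1 − a₊)`. -/
theorem stmt14 (ε : ℝ) (hε : ε ∈ Set.Ioo (0:ℝ) (1/2))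
    (a : ℕ+ → ℝ) (ha0 : ∀ i, 0 ≤ a i) (ha1 : ∀ i, a i < 1) (hsum : HasSum a 1)
    (haplus : (⨆ i, a i) < 1) :
    Summable (fun v : List ℕ+ => (1 - fword ε a v 0) ^ 2) ∧
    ∑' v : List ℕ+, (1 - fword ε a v 0) ^ 2 ≤ 1 / (1 - (⨆ i, a i)) := by
  have hbdd : BddAbove (Set.range a) := ⟨1, by rintro _ ⟨i, rfl⟩; exact (ha1 i).le⟩
  have hsq (i : ℕ+) : a i ^ 2 ≤ (⨆ j, a j) * a i := by
    rw [sq]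
    exact mul_le_mul_of_nonneg_right (le_ciSup hbdd i) (ha0 i)
  have hmul : HasSum (fun i => (⨆ j, a j) * a i) (⨆ j, a j) := by
    simpa using hsum.mul_left (⨆ j, a j)
  have hs2 : Summable fun i => a i ^ 2 :=
    hmul.summable.of_nonneg_of_le (fun i => sq_nonneg _) hsq
  have hle : ∑' i, a i ^ 2 ≤ ⨆ j, a j :=
    hmul.tsum_eq ▸ hs2.tsum_le_tsum hsq hmul.summable
  obtain ⟨hS, hT⟩ :=
    summable_list_map_prod_and_tsum_le (fun i => sq_nonneg (a i)) hs2 hle haplus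
  have hbound (v : List ℕ+) :
      (1 - fword ε a v 0) ^ 2 ≤ (v.map fun i => a i ^ 2).prod := by
    obtain ⟨h0, h1⟩ := one_sub_fword_zero_mem_Icc hε ha0 v
    have hw : (v.map fun i => a i ^ 2).prod = aword a v ^ 2 := by
      simp_rw [aword, sq, List.prod_map_mul]
    rw [hw]
    exact pow_le_pow_left₀ h0 h1 2
  have hsummable := hS.of_nonneg_of_le (fun v => sq_nonneg _) hbound
  exact ⟨hsummable, (hsummable.tsum_le_tsum hbound hS).trans hT⟩
end

section
/- Let t be a sin-tree with l_n(t) > 1 for infinitely many n. Then for every n ≥ 0: (a) p(n) = min{ p ≥ 0 : n(p) ≥ n }; (b) H_n(t) = (n − p(n)) + H_{p(n)}(f(t)); (c) n − p(n) ≤ α(p(n)), and α(p(n) − 1) ≤ n − p(n) whenever p(n) ≥ 1; moreover n − p(n) = α(p(n)) whenever u_n ∉ ℓ_∞(t). -/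
/-- An ordered rooted tree: a set of finite words over the positive integers containing the
root `[]`, closed under taking parents, and such that the children of each vertex `u` are
exactly `u·j` for `1 ≤ j ≤ k_u(t)`. -/
def IsTree (t : Set (List ℕ+)) : Prop :=
  [] ∈ t ∧ (∀ (u : List ℕ+) (j : ℕ+), u ++ [j] ∈ t → u ∈ t) ∧
    ∀ u ∈ t, ∃ k : ℕ, ∀ j : ℕ+, u ++ [j] ∈ t ↔ (j : ℕ) ≤ k

/-- The subtree of `t` above the vertex `u`:  `θ_u(t) = {w : u ++ w ∈ t}`. -/
def subtree (t : Set (List ℕ+)) (u : List ℕ+) : Set (List ℕ+) := {w | u ++ w ∈ t}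

/-- A sin-tree: an ordered rooted tree with, at every height `n`, exactly one vertex whose
subtree is infinite. -/
def IsSinTree (t : Set (List ℕ+)) : Prop :=
  IsTree t ∧ ∀ n : ℕ, ∃! u : List ℕ+, u ∈ t ∧ u.length = n ∧ (subtree t u).Infinite

/-- Strict lexicographic order on words. -/
def wlt (u v : List ℕ+) : Prop := List.Lex (· < ·) u v

/-- Lexicographic order on words. -/
def wle (u v : List ℕ+) : Prop := wlt u v ∨ u = v

theorem not_wlt_nil (u : List ℕ+) : ¬ wlt u [] := nofun

theorem lt_append_cons (u : List ℕ+) (a : ℕ+) (x : List ℕ+) : u < u ++ a :: x := by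
  induction u with
  | nil => exact List.Lex.nil
  | cons b u ih => exact List.Lex.cons ih

theorem append_lt_append_of_lt {x y : List ℕ+} (u : List ℕ+) (h : x < y) : u ++ x < u ++ y := by
  induction u with
  | nil => exact h
  | cons b u ih => exact List.Lex.cons ih

theorem exists_eq_append_of_between {v u : List ℕ+} {l : ℕ+} (h₁ : v < u) (h₂ : u < v ++ [l]) :
    ∃ a < l, ∃ w, u = v ++ a :: w := by
  induction v generalizing u with
  | nil =>
    cases h₂ with
    | nil => exact absurd h₁ (lt_irrefl _)
    | cons h => exact absurd h (by simp)
    | rel h => exact ⟨_, h, _, rfl⟩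
  | cons b v ih =>
    cases h₁ with
    | cons h =>
      cases h₂ with
      | cons h' =>
        obtain ⟨a, ha, w, rfl⟩ := ih h h'
        exact ⟨a, ha, w, rfl⟩
      | rel h' => exact absurd h' (lt_irrefl _)
    | rel h =>
      cases h₂ with
      | cons h' => exact absurd h (lt_irrefl _)
      | rel h' => exact absurd h (lt_asymm h')

theorem eq_add_of_forall_lt_iff {g h : ℕ → ℕ} (hg : g.Injective) (hh : h.Injective)
    (hdisj : ∀ q m, g q ≠ h m) (hcover : ∀ k, (∃ q, g q = k) ∨ ∃ m, h m = k) {N a b : ℕ}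
    (ha : ∀ q, g q < N ↔ q < a) (hb : ∀ m, h m < N ↔ m < b) : N = a + b := by
  have key : Finset.range N = (Finset.range a).image g ∪ (Finset.range b).image h := by
    ext k
    simp only [Finset.mem_range, Finset.mem_union, Finset.mem_image]
    constructor
    · intro hk
      rcases hcover k with ⟨q, rfl⟩ | ⟨m, rfl⟩
      · exact Or.inl ⟨q, (ha q).1 hk, rfl⟩
      · exact Or.inr ⟨m, (hb m).1 hk, rfl⟩
    · rintro (⟨q, hq, rfl⟩ | ⟨m, hm, rfl⟩)
      · exact (ha q).2 hq
      · exact (hb m).2 hm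
  have hd : Disjoint ((Finset.range a).image g) ((Finset.range b).image h) := by
    rw [Finset.disjoint_left]
    intro k hk hk'
    obtain ⟨q, -, rfl⟩ := Finset.mem_image.1 hk
    obtain ⟨m, -, hm⟩ := Finset.mem_image.1 hk'
    exact hdisj q m hm.symm
  simpa [Finset.card_union_of_disjoint hd, Finset.card_image_of_injective _ hg,
    Finset.card_image_of_injective _ hh] using congrArg Finset.card key

theorem eq_range_card_of_lower {T : Finset ℕ} (hT : ∀ i ∈ T, ∀ j < i, j ∈ T) :
    T = Finset.range T.card := by
  have hsub : T ⊆ Finset.range T.card := by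
    intro i hi
    have : Finset.range (i + 1) ⊆ T := by
      intro j hj
      rcases Nat.lt_succ_iff_lt_or_eq.1 (Finset.mem_range.1 hj) with h | rfl
      · exact hT i hi j h
      · exact hi
    have := Finset.card_le_card this
    simp only [Finset.card_range] at this
    exact Finset.mem_range.2 this
  exact Finset.eq_of_subset_of_card_le hsub (by simp)

section Line

variable {ustar : ℕ → List ℕ+} {lseq : ℕ → ℕ+}

theorem line_eq_append (hlseq : ∀ n, ustar (n + 1) = ustar n ++ [lseq n]) {i m : ℕ}
    (h : i < m) : ∃ x, ustar m = ustar i ++ lseq i :: x := by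
  induction m, h using Nat.le_induction with
  | base => exact ⟨[], hlseq i⟩
  | succ m _ ih =>
    obtain ⟨x, hx⟩ := ih
    exact ⟨x ++ [lseq m], by rw [hlseq, hx]; simp⟩

theorem branch_lt_line_append (hlseq : ∀ n, ustar (n + 1) = ustar n ++ [lseq n]) {i m : ℕ}
    (h : i < m) {a : ℕ+} (ha : a < lseq i) (w y : List ℕ+) :
    ustar i ++ a :: w < ustar m ++ y := by
  obtain ⟨x, hx⟩ := line_eq_append hlseq h
  rw [hx, List.append_assoc]
  exact append_lt_append_of_lt _ (List.Lex.rel ha)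

theorem line_lt_branch (hlseq : ∀ n, ustar (n + 1) = ustar n ++ [lseq n]) {i m : ℕ}
    (h : m ≤ i) (a : ℕ+) (w : List ℕ+) : ustar m < ustar i ++ a :: w := by
  rcases h.eq_or_lt with rfl | h
  · exact lt_append_cons _ _ _
  · obtain ⟨x, hx⟩ := line_eq_append hlseq h
    rw [hx, List.append_assoc]
    exact lt_append_cons _ _ _

theorem line_lt_branch_iff (hlseq : ∀ n, ustar (n + 1) = ustar n ++ [lseq n]) {i m : ℕ}
    {a : ℕ+} (ha : a < lseq i) (w : List ℕ+) : ustar m < ustar i ++ a :: w ↔ m ≤ i := by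
  refine ⟨fun h => ?_, fun h => line_lt_branch hlseq h a w⟩
  by_contra! hc
  have := branch_lt_line_append hlseq hc ha w []
  rw [List.append_nil] at this
  exact lt_asymm h this

theorem line_ne_branch (hlseq : ∀ n, ustar (n + 1) = ustar n ++ [lseq n]) {i m : ℕ}
    {a : ℕ+} (ha : a < lseq i) (w : List ℕ+) : ustar m ≠ ustar i ++ a :: w := by
  intro h
  rcases le_or_gt m i with hc | hc
  · exact (line_lt_branch hlseq hc a w).ne h
  · have := branch_lt_line_append hlseq hc ha w []
    rw [List.append_nil] at this
    exact this.ne h.symm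

theorem line_strictMono (hlseq : ∀ n, ustar (n + 1) = ustar n ++ [lseq n]) :
    StrictMono ustar :=
  strictMono_nat_of_lt_succ fun n => by rw [hlseq]; exact lt_append_cons _ _ _

/-- A word to the left of the infinite line is on the line or branches off to its left. -/
theorem exists_line_or_branch (hlseq : ∀ n, ustar (n + 1) = ustar n ++ [lseq n])
    (h0 : ustar 0 = []) {u : List ℕ+} {n : ℕ} (hu : u ≤ ustar n) :
    (∃ m, ustar m = u) ∨ ∃ i, ∃ a < lseq i, ∃ w, u = ustar i ++ a :: w := by
  induction n with
  | zero =>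
    refine Or.inl ⟨0, ?_⟩
    rcases hu.eq_or_lt with h | h
    · exact h.symm
    · rw [h0] at h
      exact absurd h (by simp)
  | succ n ih =>
    rcases le_or_gt u (ustar n) with h | h
    · exact ih h
    rcases hu.eq_or_lt with heq | hlt
    · exact Or.inl ⟨_, heq.symm⟩
    · rw [hlseq] at hlt
      exact Or.inr ⟨n, exists_eq_append_of_between h hlt⟩

/-- If one vertex hanging to the left of the line precedes another, its height is at most as large
and all its descendants precede those of the other. -/
theorem branch_append_lt (hlseq : ∀ n, ustar (n + 1) = ustar n ++ [lseq n]) {i i' : ℕ}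
    {a a' : ℕ+} (ha : a < lseq i) (ha' : a' < lseq i')
    (h : ustar i ++ [a] < ustar i' ++ [a']) :
    i ≤ i' ∧ ∀ w w' : List ℕ+, ustar i ++ a :: w < ustar i' ++ a' :: w' := by
  rcases lt_trichotomy i i' with hi | rfl | hi
  · exact ⟨hi.le, fun w w' => branch_lt_line_append hlseq hi ha w _⟩
  · refine ⟨le_rfl, fun w w' => append_lt_append_of_lt _ (List.Lex.rel ?_)⟩
    by_contra! hc
    rcases hc.eq_or_lt with rfl | hc
    · exact lt_irrefl _ h
    · exact lt_asymm h (append_lt_append_of_lt _ (List.Lex.rel hc))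
  · exact (lt_asymm h (branch_lt_line_append hlseq hi ha' [] [a])).elim

/-- Exactly the first `∑ n < k, (lseq n - 1)` of the vertices hanging to the left of the line are
children of the first `k` vertices of the line. -/
theorem lt_sum_iff_branch_lt (hlseq : ∀ n, ustar (n + 1) = ustar n ++ [lseq n])
    {vseq : ℕ → List ℕ+} (hv : StrictMono vseq) {I : ℕ → ℕ} {A : ℕ → ℕ+}
    (hA : ∀ j, A j < lseq (I j)) (hI : ∀ j, vseq j = ustar (I j) ++ [A j])
    (hlen : ∀ n, (ustar n).length = n)
    (hsurj : ∀ (n : ℕ) (i : ℕ+), i < lseq n → ∃ j, vseq j = ustar n ++ [i]) (j k : ℕ) :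
    j < ∑ n ∈ Finset.range k, ((lseq n : ℕ) - 1) ↔ I j < k := by
  have hex : ∀ s : (_ : ℕ) × ℕ, ∃ j, s.2 < (lseq s.1 : ℕ) - 1 →
      vseq j = ustar s.1 ++ [s.2.succPNat] := by
    intro s
    by_cases hs : s.2 < (lseq s.1 : ℕ) - 1
    · obtain ⟨j, hj⟩ := hsurj s.1 s.2.succPNat (by
        rw [← PNat.coe_lt_coe, Nat.succPNat_coe]; omega)
      exact ⟨j, fun _ => hj⟩
    · exact ⟨0, fun h => absurd h hs⟩
  choose f hf using hex
  let S : Finset ((_ : ℕ) × ℕ) :=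
    (Finset.range k).sigma fun n => Finset.range ((lseq n : ℕ) - 1)
  have hS : ∀ s ∈ S, s.1 < k ∧ s.2 < (lseq s.1 : ℕ) - 1 := by
    intro s hs
    simpa [S] using hs
  have hinj : Set.InjOn f S := by
    rintro ⟨n, x⟩ hs ⟨n', x'⟩ hs' h
    have h1 := hf _ (hS _ hs).2
    have h2 := hf _ (hS _ hs').2
    rw [h, h2] at h1
    obtain ⟨h3, h4⟩ := List.append_inj' h1 rfl
    have h5 : n' = n := by simpa [hlen] using congrArg List.length h3
    subst h5
    simp only [List.cons.injEq, and_true] at h4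
    rw [Nat.succPNat_injective h4]
  have hmem : ∀ j, j ∈ S.image f ↔ I j < k := by
    intro j
    constructor
    · intro hj
      obtain ⟨s, hs, rfl⟩ := Finset.mem_image.1 hj
      have h1 := hf _ (hS _ hs).2
      rw [hI] at h1
      have h3 := congrArg List.length h1
      simp only [List.length_append, hlen, List.length_singleton] at h3
      have := (hS _ hs).1
      omega
    · intro hj
      have h1 := hA j
      rw [← PNat.coe_lt_coe] at h1
      have h2 := (A j).pos
      have hs : (A j : ℕ) - 1 < (lseq (I j) : ℕ) - 1 := by omega
      refine Finset.mem_image.2 ⟨⟨I j, (A j : ℕ) - 1⟩, by simpa [S] using ⟨hj, hs⟩, ?_⟩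
      apply hv.injective
      rw [hf _ hs, hI]
      congr 2
      apply PNat.eq
      rw [Nat.succPNat_coe]
      simp only []
      omega
  have hlow := eq_range_card_of_lower (T := S.image f) (by
    intro i hi j hj
    rw [hmem] at hi ⊢
    have := hv hj
    rw [hI, hI i] at this
    exact (branch_append_lt hlseq (hA j) (hA i) this).1.trans_lt hi)
  rw [Finset.card_image_of_injOn hinj, Finset.card_sigma] at hlow
  simp only [Finset.card_range] at hlow
  rw [← hmem, hlow, Finset.mem_range]

end Line

section Forest

variable {s : ℕ → Set (List ℕ+)} {wseq : ℕ → ℕ × List ℕ+} {c : ℕ → ℕ} {V : ℕ → ℤ}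

theorem forest_injective
    (hwmono : ∀ p q : ℕ, p < q →
      (wseq p).1 < (wseq q).1 ∨ ((wseq p).1 = (wseq q).1 ∧ wlt (wseq p).2 (wseq q).2)) :
    wseq.Injective := by
  have key : ∀ p q, p < q → wseq p ≠ wseq q := by
    intro p q h he
    have := hwmono p q h
    rw [he] at this
    rcases this with h | ⟨-, h⟩
    · exact lt_irrefl _ h
    · exact lt_irrefl (wseq q).2 h
  intro p q h
  by_contra hne
  rcases lt_or_gt_of_ne hne with h' | h'
  · exact key p q h' h
  · exact key q p h' h.symm

theorem lt_of_forest_lt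
    (hwmono : ∀ p q : ℕ, p < q →
      (wseq p).1 < (wseq q).1 ∨ ((wseq p).1 = (wseq q).1 ∧ wlt (wseq p).2 (wseq q).2))
    {p q : ℕ} (h : (wseq p).1 < (wseq q).1 ∨
      ((wseq p).1 = (wseq q).1 ∧ (wseq p).2 < (wseq q).2)) : p < q := by
  by_contra! hc
  rcases hc.eq_or_lt with rfl | hc
  · rcases h with h | ⟨-, h⟩ <;> exact lt_irrefl _ h
  · rcases hwmono q p hc with h3 | ⟨h3, hlt⟩ <;> rcases h with h | ⟨h1, h2⟩
    · omega
    · omega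
    · omega
    · exact lt_asymm h2 hlt

/-- The Lukaciewicz path of a forest is at least minus the index of the current tree, with
equality at the roots. -/
theorem lukaciewicz_bound
    (hnil : ∀ j, [] ∈ s j) (hpar : ∀ j u a, u ++ [a] ∈ s j → u ∈ s j)
    (hwmem : ∀ p, (wseq p).2 ∈ s (wseq p).1)
    (hwmono : ∀ p q : ℕ, p < q →
      (wseq p).1 < (wseq q).1 ∨ ((wseq p).1 = (wseq q).1 ∧ wlt (wseq p).2 (wseq q).2))
    (hwsurj : ∀ (j : ℕ) (w : List ℕ+), w ∈ s j → ∃ p, wseq p = (j, w))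
    (hc : ∀ p, ∀ j : ℕ+, (wseq p).2 ++ [j] ∈ s (wseq p).1 ↔ (j : ℕ) ≤ c p)
    (hV0 : V 0 = 0) (hVs : ∀ p, V (p+1) = V p + c p - 1) (p : ℕ) :
    -((wseq p).1 : ℤ) ≤ V p ∧ ((wseq p).2 = [] → V p = -((wseq p).1 : ℤ)) := by
  have hinj := forest_injective hwmono
  have hsum : ∀ p, V p = ((∑ q ∈ Finset.range p, c q : ℕ) : ℤ) - p := by
    intro p
    induction p with
    | zero => simp [hV0]
    | succ p ih =>
      rw [hVs, ih, Finset.sum_range_succ]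
      push_cast
      ring
  have hex : ∀ x : (_ : ℕ) × ℕ, ∃ r, x.2 < c x.1 →
      wseq r = ((wseq x.1).1, (wseq x.1).2 ++ [x.2.succPNat]) := by
    intro x
    by_cases hx : x.2 < c x.1
    · obtain ⟨r, hr⟩ := hwsurj _ _ ((hc x.1 x.2.succPNat).2 (by rw [Nat.succPNat_coe]; omega))
      exact ⟨r, fun _ => hr⟩
    · exact ⟨0, fun h => absurd h hx⟩
  choose f hf using hex
  let S : Finset ((_ : ℕ) × ℕ) := (Finset.range p).sigma fun q => Finset.range (c q)
  have hS : ∀ x ∈ S, x.1 < p ∧ x.2 < c x.1 := by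
    intro x hx
    simpa [S] using hx
  have hfinj : Set.InjOn f S := by
    rintro ⟨q, x⟩ hs ⟨q', x'⟩ hs' h
    have h1 := hf _ (hS _ hs).2
    have h2 := hf _ (hS _ hs').2
    rw [h, h2, Prod.mk.injEq] at h1
    obtain ⟨h3, h4⟩ := List.append_inj' h1.2 rfl
    have h5 : q' = q := hinj (Prod.ext h1.1 h3)
    subst h5
    simp only [List.cons.injEq, and_true] at h4
    rw [Nat.succPNat_injective h4]
  have hcardS : (S.image f).card = ∑ q ∈ Finset.range p, c q := by
    rw [Finset.card_image_of_injOn hfinj, Finset.card_sigma]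
    simp
  choose r hr using fun j => hwsurj j [] (hnil j)
  have hrinj : r.Injective := by
    intro j j' h
    have := hr j
    rw [h, hr j'] at this
    exact (congrArg Prod.fst this).symm
  have hrle : ∀ j, r j ≤ p ↔ j ≤ (wseq p).1 := by
    intro j
    constructor
    · intro h
      by_contra! hlt
      have := lt_of_forest_lt hwmono (p := p) (q := r j) (Or.inl (by rw [hr]; exact hlt))
      omega
    · intro h
      by_contra! hlt
      have := hwmono _ _ hlt
      rw [hr] at this
      rcases this with h' | ⟨-, h'⟩
      · simp only [] at h'
        omega
      · exact not_wlt_nil _ h'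
  have hroots : (Finset.range (p + 1)).filter (fun q => (wseq q).2 = []) =
      (Finset.range ((wseq p).1 + 1)).image r := by
    ext q
    simp only [Finset.mem_filter, Finset.mem_range, Finset.mem_image]
    constructor
    · rintro ⟨hq, hq'⟩
      have : r (wseq q).1 = q := hinj (by rw [hr, ← hq'])
      refine ⟨(wseq q).1, ?_, this⟩
      have := (hrle (wseq q).1).1 (by omega)
      omega
    · rintro ⟨j, hj, rfl⟩
      refine ⟨?_, by rw [hr]⟩
      have := (hrle j).2 (by omega)
      omega
  have hcount := Finset.card_filter_add_card_filter_not (s := Finset.range (p + 1))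
    (fun q => (wseq q).2 = [])
  rw [hroots, Finset.card_image_of_injective _ hrinj, Finset.card_range, Finset.card_range]
    at hcount
  have hsub : (Finset.range (p + 1)).filter (fun q => ¬ (wseq q).2 = []) ⊆ S.image f := by
    intro q hq
    obtain ⟨hq, hne⟩ := Finset.mem_filter.1 hq
    rw [Finset.mem_range] at hq
    obtain ⟨u, a, hu⟩ : ∃ u a, (wseq q).2 = u ++ [a] :=
      ⟨_, _, (List.dropLast_append_getLast hne).symm⟩
    have hm := hwmem q
    rw [hu] at hm
    obtain ⟨q', hq'⟩ := hwsurj _ _ (hpar _ _ _ hm)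
    have hlt : q' < q := lt_of_forest_lt hwmono (Or.inr (by
      rw [hq', hu]; exact ⟨rfl, lt_append_cons _ _ _⟩))
    have hac : (a : ℕ) ≤ c q' := (hc q' a).1 (by rw [hq']; exact hm)
    have hpos := a.pos
    have hx : (a : ℕ) - 1 < c q' := by omega
    refine Finset.mem_image.2 ⟨⟨q', (a : ℕ) - 1⟩, ?_, ?_⟩
    · simp only [S, Finset.mem_sigma, Finset.mem_range]
      omega
    · apply hinj
      rw [hf _ hx]
      refine Prod.ext (by rw [hq']) ?_
      simp only [hq', hu]
      congr 2
      apply PNat.eq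
      rw [Nat.succPNat_coe]
      omega
  have hle := Finset.card_le_card hsub
  refine ⟨?_, fun hroot => ?_⟩
  · rw [hsum]
    omega
  · have hsub' : S.image f ⊆ (Finset.range (p + 1)).filter (fun q => ¬ (wseq q).2 = []) := by
      intro q hq
      obtain ⟨x, hx, rfl⟩ := Finset.mem_image.1 hq
      have h1 := hf _ (hS _ hx).2
      have h2 : (wseq x.1).1 < (wseq p).1 := by
        rcases hwmono _ _ (hS _ hx).1 with h | ⟨-, h⟩
        · exact h
        · rw [hroot] at h
          exact (not_wlt_nil _ h).elim
      have h3 : f x < p := lt_of_forest_lt hwmono (Or.inl (by rw [h1]; exact h2))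
      rw [Finset.mem_filter, Finset.mem_range, h1]
      exact ⟨by omega, by simp⟩
    have hle' := Finset.card_le_card hsub'
    rw [hsum]
    omega

/-- The running minimum of the Lukaciewicz path of a forest counts the trees already explored. -/
theorem forall_lukaciewicz_le_iff
    (hnil : ∀ j, [] ∈ s j) (hpar : ∀ j u a, u ++ [a] ∈ s j → u ∈ s j)
    (hwmem : ∀ p, (wseq p).2 ∈ s (wseq p).1)
    (hwmono : ∀ p q : ℕ, p < q →
      (wseq p).1 < (wseq q).1 ∨ ((wseq p).1 = (wseq q).1 ∧ wlt (wseq p).2 (wseq q).2))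
    (hwsurj : ∀ (j : ℕ) (w : List ℕ+), w ∈ s j → ∃ p, wseq p = (j, w))
    (hc : ∀ p, ∀ j : ℕ+, (wseq p).2 ++ [j] ∈ s (wseq p).1 ↔ (j : ℕ) ≤ c p)
    (hV0 : V 0 = 0) (hVs : ∀ p, V (p+1) = V p + c p - 1) (p x : ℕ) :
    (∀ j ≤ p, 1 - V j ≤ (x : ℤ)) ↔ (wseq p).1 < x := by
  have hb := lukaciewicz_bound hnil hpar hwmem hwmono hwsurj hc hV0 hVs
  constructor
  · intro h
    obtain ⟨r, hr⟩ := hwsurj (wseq p).1 [] (hnil _)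
    have hrp : r ≤ p := by
      by_contra! hlt
      have := hwmono _ _ hlt
      rw [hr] at this
      rcases this with h' | ⟨-, h'⟩
      · exact lt_irrefl _ h'
      · exact not_wlt_nil _ h'
    have h1 := h r hrp
    have h2 := (hb r).2 (by rw [hr])
    rw [hr] at h2
    simp only [] at h2
    omega
  · intro h j hj
    have h1 := (hb j).1
    have h2 : (wseq j).1 ≤ (wseq p).1 := by
      rcases hj.eq_or_lt with rfl | hj
      · exact le_rfl
      · rcases hwmono _ _ hj with h | ⟨h, -⟩ <;> omega
    omega

end Forest

/-- Decomposition of the left height process of a sin-tree `t` along its infinite line of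
descent.  Here `ustar n = u*_n(t)`, `lseq n = l_{n+1}(t)` (so `ustar (n+1) = ustar n · lseq n`),
`e` enumerates the left part of `t` in increasing lexicographic order (`H_n(t) = |e n|`),
`vseq` enumerates `{u*_{n}(t)·i : n ≥ 0, 1 ≤ i < l_{n+1}(t)}` in increasing lexicographic
order, `wseq` enumerates the vertices `(j, w)` (with `w ∈ θ_{v_j}(t)`) of the forest `f(t)` in
increasing order (first by `j`, then lexicographically in `w`), so that the height process of
`f(t)` is `H_p(f(t)) = |(wseq p).2|`, `c p` is the number of children of the `p`-th vertex of
`f(t)`, `V` is the Lukaciewicz path of `f(t)`, `L n = (l_1(t)−1)+⋯+(l_n(t)−1)`,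
`α p = min{k : L_k ≥ 1 − min_{j≤p} V_j}`, `n(p) = p + α(p)` and
`pfun n = #{k < n : e k ∉ ℓ_∞(t)}`.  Assuming `l_n(t) > 1` for infinitely many `n`, then:
(a) `pfun n = min{p : n(p) ≥ n}`; (b) `H_n(t) = (n − pfun n) + H_{pfun n}(f(t))`;
(c) `n − pfun n ≤ α(pfun n)`, `α(pfun n − 1) ≤ n − pfun n` whenever `pfun n ≥ 1`, and
`n − pfun n = α(pfun n)` whenever `e n ∉ ℓ_∞(t)`. -/
theorem stmt17 (t : Set (List ℕ+)) (ht : IsSinTree t)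
    (ustar : ℕ → List ℕ+)
    (hustar : ∀ n, ustar n ∈ t ∧ (ustar n).length = n ∧ (subtree t (ustar n)).Infinite)
    (lseq : ℕ → ℕ+)
    (hlseq : ∀ n, ustar (n+1) = ustar n ++ [lseq n])
    (hinf : {n : ℕ | 1 < (lseq n : ℕ)}.Infinite)
    (e : ℕ → List ℕ+)
    (hemono : ∀ m n : ℕ, m < n → wlt (e m) (e n))
    (herange : ∀ u : List ℕ+, (∃ k, e k = u) ↔ (u ∈ t ∧ ∃ n, wle u (ustar n)))
    (vseq : ℕ → List ℕ+)
    (hvmono : ∀ m n : ℕ, m < n → wlt (vseq m) (vseq n))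
    (hvrange : ∀ x : List ℕ+,
      (∃ j, vseq j = x) ↔ ∃ (n : ℕ) (i : ℕ+), (i : ℕ) < (lseq n : ℕ) ∧ x = ustar n ++ [i])
    (wseq : ℕ → ℕ × List ℕ+)
    (hwmem : ∀ p, (wseq p).2 ∈ subtree t (vseq (wseq p).1))
    (hwmono : ∀ p q : ℕ, p < q →
      (wseq p).1 < (wseq q).1 ∨ ((wseq p).1 = (wseq q).1 ∧ wlt (wseq p).2 (wseq q).2))
    (hwsurj : ∀ (j : ℕ) (w : List ℕ+), w ∈ subtree t (vseq j) → ∃ p, wseq p = (j, w))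
    (c : ℕ → ℕ)
    (hc : ∀ p, ∀ j : ℕ+, (wseq p).2 ++ [j] ∈ subtree t (vseq (wseq p).1) ↔ (j : ℕ) ≤ c p)
    (V : ℕ → ℤ) (hV0 : V 0 = 0) (hVs : ∀ p, V (p+1) = V p + c p - 1)
    (L : ℕ → ℕ) (hL : ∀ n, L n = ∑ k ∈ Finset.range n, ((lseq k : ℕ) - 1))
    (α : ℕ → ℕ)
    (hα : ∀ p, IsLeast {k : ℕ | ∀ j ≤ p, 1 - V j ≤ (L k : ℤ)} (α p))
    (pfun : ℕ → ℕ)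
    (hpfun : ∀ n, pfun n = {k : ℕ | k < n ∧ e k ∉ Set.range ustar}.ncard)
    (n : ℕ) :
    pfun n = sInf {p : ℕ | n ≤ p + α p} ∧
    (e n).length = (n - pfun n) + ((wseq (pfun n)).2).length ∧
    n - pfun n ≤ α (pfun n) ∧
    (1 ≤ pfun n → α (pfun n - 1) ≤ n - pfun n) ∧
    (e n ∉ Set.range ustar → n - pfun n = α (pfun n)) := by
  have h0 : ustar 0 = [] := List.length_eq_zero_iff.1 (hustar 0).2.1
  have hlen : ∀ n, (ustar n).length = n := fun n => (hustar n).2.1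
  have hex : ∀ j, ∃ (i : ℕ) (a : ℕ+), a < lseq i ∧ vseq j = ustar i ++ [a] :=
    fun j => (hvrange (vseq j)).1 ⟨j, rfl⟩
  choose I A hA hI using hex
  have hvt : ∀ j, [] ∈ subtree t (vseq j) := by
    intro j
    obtain ⟨k, hk⟩ := ht.1.2.2 (ustar (I j)) (hustar _).1
    have h1 := (hk (lseq (I j))).1 (by rw [← hlseq]; exact (hustar _).1)
    have h2 : (A j : ℕ) < lseq (I j) := hA j
    have h3 := (hk (A j)).2 (by omega)
    simpa [subtree, hI] using h3
  have hαI : ∀ p, α p = I (wseq p).1 + 1 := by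
    intro p
    refine (hα p).unique ?_
    have hset : {k : ℕ | ∀ j ≤ p, 1 - V j ≤ (L k : ℤ)} = Set.Ici (I (wseq p).1 + 1) := by
      ext k
      rw [Set.mem_ofPred_eq, forall_lukaciewicz_le_iff (s := fun j => subtree t (vseq j)) hvt
        (fun j u a h => ht.1.2.1 _ a (by simpa [subtree] using h)) hwmem hwmono hwsurj hc hV0 hVs,
        hL, lt_sum_iff_branch_lt hlseq hvmono hA hI hlen
        (fun n i hi => (hvrange _).2 ⟨n, i, hi, rfl⟩)]
      rfl
    rw [hset]
    exact isLeast_Ici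
  let φ : ℕ → List ℕ+ := fun p => vseq (wseq p).1 ++ (wseq p).2
  have hφ : ∀ p, φ p = ustar (I (wseq p).1) ++ A (wseq p).1 :: (wseq p).2 := by
    intro p
    simp [φ, hI]
  have hφmono : StrictMono φ := by
    intro p q hpq
    rcases hwmono p q hpq with h | ⟨h, h'⟩
    · have h1 := hvmono _ _ h
      rw [hI, hI (wseq q).1] at h1
      rw [hφ, hφ]
      exact (branch_append_lt hlseq (hA _) (hA _) h1).2 _ _
    · simp only [φ, h]
      exact append_lt_append_of_lt _ h'
  have hemono' : StrictMono e := hemono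
  have hgex : ∀ p, ∃ k, e k = φ p := by
    intro p
    refine (herange _).2 ⟨hwmem p, I (wseq p).1 + 1, Or.inl ?_⟩
    have := branch_lt_line_append hlseq (Nat.lt_succ_self _) (hA (wseq p).1) (wseq p).2 []
    rw [List.append_nil, ← hφ] at this
    exact this
  choose g hg using hgex
  choose h hh using fun m => (herange (ustar m)).2 ⟨(hustar m).1, m, Or.inr rfl⟩
  have hgmono : StrictMono g := fun p q hpq => by
    rw [← hemono'.lt_iff_lt, hg, hg]
    exact hφmono hpq
  have hhmono : StrictMono h := fun p q hpq => by
    rw [← hemono'.lt_iff_lt, hh, hh]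
    exact line_strictMono hlseq hpq
  have hoff : ∀ p m, ustar m ≠ φ p := fun p m => by
    rw [hφ]
    exact line_ne_branch hlseq (hA _) _
  have hdisj : ∀ q m, g q ≠ h m := fun q m hq => hoff q m (by rw [← hg, hq, hh])
  have hcover : ∀ k, (∃ q, g q = k) ∨ ∃ m, h m = k := by
    intro k
    obtain ⟨hkt, n, hn⟩ := (herange (e k)).1 ⟨k, rfl⟩
    have hn' : e k ≤ ustar n := hn.elim (fun h : e k < ustar n => h.le) (fun h => h.le)
    rcases exists_line_or_branch hlseq h0 hn' with ⟨m, hm⟩ | ⟨i, a, ha, w, hw⟩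
    · exact Or.inr ⟨m, hemono'.injective (by rw [hh, hm])⟩
    · obtain ⟨j, hj⟩ := (hvrange _).2 ⟨i, a, ha, rfl⟩
      have hkw : vseq j ++ w = e k := by rw [hj, hw]; simp
      obtain ⟨p, hp⟩ := hwsurj j w (by rw [← hkw] at hkt; exact hkt)
      exact Or.inl ⟨p, hemono'.injective (by rw [hg, ← hkw]; simp only [φ, hp])⟩
  have hgα : ∀ p, g p = p + α p := by
    intro p
    refine eq_add_of_forall_lt_iff hgmono.injective hhmono.injective hdisj hcover
      (fun q => hgmono.lt_iff_lt) (fun m => ?_)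
    rw [← hemono'.lt_iff_lt, hg, hh, hφ, line_lt_branch_iff hlseq (hA _), hαI, Nat.lt_succ_iff]
  have hne : {p : ℕ | n ≤ p + α p}.Nonempty := ⟨n, Nat.le_add_right _ _⟩
  set P := sInf {p : ℕ | n ≤ p + α p} with hP
  have hmem : n ≤ g P := by
    rw [hgα]
    exact Nat.sInf_mem hne
  have hlt : ∀ q, g q < n ↔ q < P := by
    intro q
    constructor
    · intro hq
      exact hgmono.lt_iff_lt.1 (hq.trans_le hmem)
    · intro hq
      have := Nat.notMem_of_lt_sInf hq
      rw [Set.mem_ofPred_eq, ← hgα] at this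
      omega
  have hpP : pfun n = P := by
    have hset : {k : ℕ | k < n ∧ e k ∉ Set.range ustar} = (Finset.range P).image g := by
      ext k
      simp only [Set.mem_ofPred_eq, Finset.coe_image, Finset.coe_range, Set.mem_image,
        Set.mem_Iio]
      constructor
      · rintro ⟨hk, hk'⟩
        rcases hcover k with ⟨q, rfl⟩ | ⟨m, rfl⟩
        · exact ⟨q, (hlt q).1 hk, rfl⟩
        · exact absurd ⟨m, (hh m).symm⟩ hk'
      · rintro ⟨q, hq, rfl⟩
        refine ⟨(hlt q).2 hq, ?_⟩
        rintro ⟨m, hm⟩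
        exact hoff q m (by rw [hm, hg])
    rw [hpfun, hset, Set.ncard_coe_finset, Finset.card_image_of_injective _ hgmono.injective,
      Finset.card_range]
  have hPg : ∀ q, g q = n → P = q := by
    rintro q rfl
    have h1 := hgmono.le_iff_le.1 hmem
    have h2 := (hlt P).not.2 (lt_irrefl _)
    have h3 : P ≤ q := by
      by_contra! hc
      exact lt_irrefl _ ((hlt q).2 hc)
    omega
  rw [hpP]
  refine ⟨rfl, ?_, ?_, ?_, ?_⟩
  · rcases hcover n with ⟨q, hq⟩ | ⟨m, hm⟩
    · have hPq := hPg q hq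
      have h1 := hgα q
      have h2 : (e n).length = α q + (wseq q).2.length := by
        rw [← hq, hg, hφ, hαI, List.length_append, hlen, List.length_cons]
        omega
      rw [hPq, h2]
      omega
    · have hnm : n = P + m := eq_add_of_forall_lt_iff hgmono.injective hhmono.injective hdisj
        hcover hlt (fun m' => by rw [← hm]; exact hhmono.lt_iff_lt)
      have hroot : (wseq P).2 = [] := by
        by_contra hw
        obtain ⟨r, hr⟩ := hwsurj (wseq P).1 [] (hvt _)
        have hrP : r < P := lt_of_forest_lt hwmono (Or.inr (by
          rw [hr]
          obtain ⟨a, x, hx⟩ := List.exists_cons_of_ne_nil hw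
          rw [hx]
          exact ⟨rfl, List.Lex.nil⟩))
        have h1 := (hlt r).2 hrP
        have h2 : n < g P := lt_of_le_of_ne hmem (fun h' => hdisj P m (by rw [← h', hm]))
        rw [← hm, ← hemono'.lt_iff_lt, hg, hh, hφ] at h1 h2
        rw [line_lt_branch_iff hlseq (hA _)] at h2
        refine lt_asymm h1 ?_
        rw [hr]
        exact line_lt_branch hlseq h2 _ _
      rw [hroot, ← hm, hh, hlen, List.length_nil, hm]
      omega
  · rw [hgα] at hmem
    omega
  · intro hP1
    have := (hlt (P - 1)).2 (by omega)
    rw [hgα] at this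
    omega
  · intro hn
    rcases hcover n with ⟨q, hq⟩ | ⟨m, hm⟩
    · have h1 := hPg q hq
      have h2 := hgα q
      rw [h1]
      omega
    · exact absurd ⟨m, by rw [← hm, hh]⟩ hn
end
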